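/- For fixed A ≥ 2 and k ≥ 0, as n → ∞, p_{≤k}(A;n) ∼ (24^{k/2 − 1/4} n^{k/2 − 3/4}) / (√2 (1 − 1/A)^{k/2 − 1/4} k! A^{k + 1/2} (2π)^k) · exp(2π √((1/6)(1 − 1/A) n)). -/

import Mathlib

open Finset

/-- number of partitions of `n` -/
def pcount (n : ℕ) : ℕ := Fintype.card (Nat.Partition n)

/-- partitions of `n` with at most `k` parts -/
def pleParts (k n : ℕ) : ℕ :=
  (Finset.univ.filter (fun π : Nat.Partition n => π.parts.card ≤ k)).card

/-- partitions of `n` with at most `k` parts divisible by `A` -/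
def pleA (A k n : ℕ) : ℕ :=
  (Finset.univ.filter
    (fun π : Nat.Partition n => (π.parts.filter (fun r => A ∣ r)).card ≤ k)).card

/-- partitions of `n` with exactly `k` parts divisible by `A` -/
def pexact (A k n : ℕ) : ℕ :=
  (Finset.univ.filter
    (fun π : Nat.Partition n => (π.parts.filter (fun r => A ∣ r)).card = k)).card

/-- `A`-regular partitions of `n` -/
def preg (A n : ℕ) : ℕ :=
  (Finset.univ.filter (fun π : Nat.Partition n => ∀ r ∈ π.parts, ¬ A ∣ r)).card

/-- the Erdős–Lehner sums `S_k(m;j)` -/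
def Sk (k m j : ℕ) : ℕ :=
  ∑ R ∈ ((Finset.Icc 1 j).powersetCard m).filter (fun R => ∑ r ∈ R, (k + r) ≤ j),
    pcount (j - ∑ r ∈ R, (k + r))

section Combinatorics

variable {A k n : ℕ}

lemma Multiset.filter_compl_add_filter (p : ℕ → Prop) [DecidablePred p] (s : Multiset ℕ) :
    s.filter (fun r => ¬ p r) + s.filter p = s := by
  rw [add_comm]; exact Multiset.filter_add_not p s

/-- Pad the multiples of `A` in `s` by zeros until there are `k` of them, then raise each by `A`. -/
def raiseMultiples (A k : ℕ) (s : Multiset ℕ) : Multiset ℕ :=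
  s.filter (fun r => ¬ A ∣ r) +
    (s.filter (fun r => A ∣ r) +
      Multiset.replicate (k - (s.filter (fun r => A ∣ r)).card) 0).map (· + A)

/-- Lower each multiple of `A` in `s` by `A` and discard the resulting zeros. -/
def lowerMultiples (A : ℕ) (s : Multiset ℕ) : Multiset ℕ :=
  s.filter (fun r => ¬ A ∣ r) +
    ((s.filter (fun r => A ∣ r)).map (· - A)).filter (fun r => r ≠ 0)

lemma filter_not_raiseMultiples (s : Multiset ℕ) :
    (raiseMultiples A k s).filter (fun r => ¬ A ∣ r) = s.filter (fun r => ¬ A ∣ r) := by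
  rw [raiseMultiples, Multiset.filter_add, Multiset.filter_filter]
  simp only [and_self]
  rw [add_eq_left, Multiset.filter_eq_nil]
  intro a ha
  simp only [Multiset.mem_map, Multiset.mem_add, Multiset.mem_filter, Multiset.mem_replicate] at ha
  obtain ⟨b, hb | hb, rfl⟩ := ha
  · simpa using hb.2
  · simp [hb.2]

lemma filter_raiseMultiples (s : Multiset ℕ) :
    (raiseMultiples A k s).filter (fun r => A ∣ r) = (s.filter (fun r => A ∣ r) +
      Multiset.replicate (k - (s.filter (fun r => A ∣ r)).card) 0).map (· + A) := by
  rw [raiseMultiples, Multiset.filter_add, Multiset.filter_filter]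
  simp only [and_not_self, Multiset.filter_false, zero_add]
  rw [Multiset.filter_eq_self]
  intro a ha
  simp only [Multiset.mem_map, Multiset.mem_add, Multiset.mem_filter, Multiset.mem_replicate] at ha
  obtain ⟨b, hb | hb, rfl⟩ := ha
  · simpa using hb.2
  · simp [hb.2]

lemma sum_raiseMultiples (s : Multiset ℕ) (h : (s.filter (fun r => A ∣ r)).card ≤ k) :
    (raiseMultiples A k s).sum = s.sum + A * k := by
  conv_rhs => rw [← Multiset.filter_compl_add_filter (A ∣ ·) s]
  simp only [raiseMultiples, Multiset.sum_add, Multiset.map_add, Multiset.sum_map_add,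
    Multiset.map_id', Multiset.map_const', Multiset.sum_replicate, Multiset.map_replicate]
  simp only [smul_eq_mul, zero_add]
  have : k = (s.filter (fun r => A ∣ r)).card + (k - (s.filter (fun r => A ∣ r)).card) := by omega
  conv_rhs => rw [this]
  ring

lemma filter_not_lowerMultiples (s : Multiset ℕ) :
    (lowerMultiples A s).filter (fun r => ¬ A ∣ r) = s.filter (fun r => ¬ A ∣ r) := by
  rw [lowerMultiples, Multiset.filter_add, Multiset.filter_filter]
  simp only [and_self]
  rw [add_eq_left, Multiset.filter_eq_nil]
  intro a ha
  simp only [Multiset.mem_map, Multiset.mem_filter] at ha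
  obtain ⟨⟨b, hb, rfl⟩, -⟩ := ha
  exact not_not.2 (Nat.dvd_sub hb.2 dvd_rfl)

lemma filter_lowerMultiples (s : Multiset ℕ) :
    (lowerMultiples A s).filter (fun r => A ∣ r) =
      ((s.filter (fun r => A ∣ r)).map (· - A)).filter (fun r => r ≠ 0) := by
  rw [lowerMultiples, Multiset.filter_add, Multiset.filter_filter]
  simp only [and_not_self, Multiset.filter_false, zero_add]
  rw [Multiset.filter_eq_self]
  intro a ha
  simp only [Multiset.mem_map, Multiset.mem_filter] at ha
  obtain ⟨⟨b, hb, rfl⟩, -⟩ := ha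
  exact Nat.dvd_sub hb.2 dvd_rfl

lemma lowerMultiples_raiseMultiples (s : Multiset ℕ) (hs : ∀ i ∈ s, 0 < i) :
    lowerMultiples A (raiseMultiples A k s) = s := by
  rw [lowerMultiples, filter_not_raiseMultiples, filter_raiseMultiples, Multiset.map_map]
  conv_rhs => rw [← Multiset.filter_compl_add_filter (A ∣ ·) s]
  congr 1
  simp only [Function.comp_def, Nat.add_sub_cancel, Multiset.map_id', Multiset.filter_add]
  rw [add_eq_left.2, Multiset.filter_eq_self.2]
  · intro a ha
    exact (hs a (Multiset.mem_of_mem_filter ha)).ne'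
  · rw [Multiset.filter_eq_nil]
    intro a ha
    simpa using Multiset.eq_of_mem_replicate ha

lemma sub_add_lowered (s : Multiset ℕ) (hs : ∀ i ∈ s, 0 < i) :
    ((s.filter (fun r => A ∣ r)).map (· - A)).map (· + A) = s.filter (fun r => A ∣ r) := by
  rw [Multiset.map_map]
  conv_rhs => rw [← Multiset.map_id (s.filter (fun r => A ∣ r))]
  refine Multiset.map_congr rfl fun a ha => ?_
  have ha' := Multiset.mem_filter.1 ha
  have := Nat.le_of_dvd (hs a ha'.1) ha'.2
  simp only [Function.comp, id]
  omega

lemma lowered_pad (s : Multiset ℕ) (h : s.card = k) :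
    s.filter (fun r => r ≠ 0) + Multiset.replicate (k - (s.filter (fun r => r ≠ 0)).card) 0 = s := by
  conv_rhs => rw [← Multiset.filter_compl_add_filter (· = 0) s]
  congr 1
  rw [Multiset.filter_eq', Multiset.count_eq_card_filter_eq]
  congr 1
  have := congrArg Multiset.card (Multiset.filter_compl_add_filter (· = 0) s)
  rw [Multiset.card_add] at this
  simp only [eq_comm (a := (0 : ℕ))]
  simp only [ne_eq]
  omega

lemma raiseMultiples_lowerMultiples (s : Multiset ℕ) (hs : ∀ i ∈ s, 0 < i)
    (h : (s.filter (fun r => A ∣ r)).card = k) :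
    raiseMultiples A k (lowerMultiples A s) = s := by
  rw [raiseMultiples, filter_not_lowerMultiples, filter_lowerMultiples,
    lowered_pad _ (by simpa using h), sub_add_lowered s hs]
  exact Multiset.filter_compl_add_filter (A ∣ ·) s

lemma pexact_add_mul (hA : 0 < A) : pexact A k (n + A * k) = pleA A k n := by
  symm
  unfold pexact pleA
  have key : ∀ π : Nat.Partition (n + A * k), (π.parts.filter (fun r => A ∣ r)).card = k →
      (lowerMultiples A π.parts).sum = n ∧
        ((lowerMultiples A π.parts).filter (fun r => A ∣ r)).card ≤ k := by
    intro π h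
    have hle : ((lowerMultiples A π.parts).filter (fun r => A ∣ r)).card ≤ k := by
      rw [filter_lowerMultiples]
      refine (Multiset.card_le_card (Multiset.filter_le _ _)).trans ?_
      simp [h]
    refine ⟨?_, hle⟩
    have := sum_raiseMultiples (lowerMultiples A π.parts) hle
    rw [raiseMultiples_lowerMultiples _ (fun i hi => π.parts_pos hi) h, π.parts_sum] at this
    omega
  refine Finset.card_bij'
    (fun π hπ => ⟨raiseMultiples A k π.parts, ?_, ?_⟩)
    (fun π hπ => ⟨lowerMultiples A π.parts, ?_, ?_⟩) ?_ ?_ ?_ ?_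
  · intro i hi
    rw [← Multiset.filter_compl_add_filter (A ∣ ·) (raiseMultiples A k π.parts),
      filter_not_raiseMultiples, filter_raiseMultiples] at hi
    simp only [Multiset.mem_add, Multiset.mem_filter, Multiset.mem_map] at hi
    obtain hi | ⟨a, -, rfl⟩ := hi
    · exact π.parts_pos hi.1
    · omega
  · rw [sum_raiseMultiples _ (by simpa using hπ), π.parts_sum]
  · intro i hi
    rw [lowerMultiples] at hi
    simp only [Multiset.mem_add, Multiset.mem_filter] at hi
    obtain hi | hi := hi
    · exact π.parts_pos hi.1
    · exact Nat.pos_of_ne_zero hi.2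
  · exact (key π (by simpa using hπ)).1
  · intro π hπ
    have : (π.parts.filter (fun r => A ∣ r)).card ≤ k := by simpa using hπ
    simp only [Finset.mem_filter, Finset.mem_univ, true_and, filter_raiseMultiples,
      Multiset.card_map, Multiset.card_add, Multiset.card_replicate]
    omega
  · intro π hπ
    simpa using (key π (by simpa using hπ)).2
  · intro π hπ
    ext1
    exact lowerMultiples_raiseMultiples _ (fun i hi => π.parts_pos hi)
  · intro π hπ
    ext1
    exact raiseMultiples_lowerMultiples _ (fun i hi => π.parts_pos hi) (by simpa using hπ)

lemma pexact_eq_zero (h : n < A * k) : pexact A k n = 0 := by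
  unfold pexact
  rw [Finset.card_eq_zero, Finset.filter_eq_empty_iff]
  intro π _ hπ
  have h1 : (π.parts.filter (fun r => A ∣ r)).sum ≤ n := by
    conv_rhs => rw [← π.parts_sum, ← Multiset.filter_compl_add_filter (A ∣ ·) π.parts]
    rw [Multiset.sum_add]
    omega
  have h2 : (π.parts.filter (fun r => A ∣ r)).card • A ≤ (π.parts.filter (fun r => A ∣ r)).sum := by
    refine Multiset.card_nsmul_le_sum fun a ha => ?_
    have ha' := Multiset.mem_filter.1 ha
    exact Nat.le_of_dvd (π.parts_pos ha'.1) ha'.2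
  rw [hπ, smul_eq_mul, mul_comm] at h2
  omega

lemma pleA_succ : pleA A (k + 1) n = pleA A k n + pexact A (k + 1) n := by
  unfold pleA pexact
  rw [← Finset.card_union_of_disjoint, ← Finset.filter_or]
  · simp only [Nat.le_succ_iff, Nat.succ_eq_add_one]
  · rw [Finset.disjoint_filter]
    intro π _ h
    omega

lemma pleA_zero_eq_preg : pleA A 0 n = preg A n := by
  unfold pleA preg
  congr 1
  ext π
  simp [Multiset.filter_eq_nil]

end Combinatorics

section GeneratingFunctions

open PowerSeries

/-- The power series `F` converges absolutely at `q`, with value `v`. -/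
def EvalsTo (F : PowerSeries ℂ) (q v : ℂ) : Prop :=
  Summable (fun n => ‖coeff n F * q ^ n‖) ∧ ∑' n, coeff n F * q ^ n = v

lemma EvalsTo.mul {F G : PowerSeries ℂ} {q v w : ℂ} (hF : EvalsTo F q v) (hG : EvalsTo G q w) :
    EvalsTo (F * G) q (v * w) := by
  have h : ∀ n, ∑ kl ∈ Finset.HasAntidiagonal.antidiagonal n,
      (coeff kl.1 F * q ^ kl.1) * (coeff kl.2 G * q ^ kl.2)
      = coeff n (F * G) * q ^ n := by
    intro n
    rw [coeff_mul, Finset.sum_mul]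
    refine Finset.sum_congr rfl fun kl hkl => ?_
    rw [← Finset.HasAntidiagonal.mem_antidiagonal.1 hkl, pow_add]
    ring
  refine ⟨?_, ?_⟩
  · simpa only [h] using summable_norm_sum_mul_antidiagonal_of_summable_norm hF.1 hG.1
  · rw [← hF.2, ← hG.2, tsum_mul_tsum_eq_tsum_sum_antidiagonal_of_summable_norm hF.1 hG.1]
    simp only [h]

lemma EvalsTo.one (q : ℂ) : EvalsTo 1 q 1 := by
  have h : ∀ n, coeff n (1 : PowerSeries ℂ) * q ^ n = if n = 0 then 1 else 0 := by
    intro n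
    rw [coeff_one]
    split_ifs with hn <;> simp [hn]
  refine ⟨?_, ?_⟩
  · simp only [h]
    exact summable_of_ne_finset_zero (s := {0}) (by intro b hb; simp_all)
  · simp only [h, tsum_ite_eq]

lemma EvalsTo.prod {ι : Type*} {F : ι → PowerSeries ℂ} {v : ι → ℂ} {q : ℂ} (s : Finset ι)
    (h : ∀ i ∈ s, EvalsTo (F i) q (v i)) : EvalsTo (∏ i ∈ s, F i) q (∏ i ∈ s, v i) := by
  classical
  induction s using Finset.induction_on with
  | empty => simpa using EvalsTo.one q
  | insert a s ha ih =>
    rw [Finset.prod_insert ha, Finset.prod_insert ha]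
    exact (h a (by simp)).mul (ih fun i hi => h i (by simp [hi]))

/-- The geometric series in `X ^ m`. -/
noncomputable def geomSeries (m : ℕ) : PowerSeries ℂ :=
  PowerSeries.mk fun n => if m ∣ n then 1 else 0

lemma geomSeries_mul {m : ℕ} (hm : 0 < m) : geomSeries m * (1 - X ^ m) = 1 := by
  ext n
  rw [mul_sub, mul_one, map_sub, coeff_mul_X_pow', coeff_one]
  simp only [geomSeries, coeff_mk]
  by_cases h : m ≤ n
  · have h0 : n ≠ 0 := by omega
    have hd : m ∣ n - m ↔ m ∣ n := by
      rw [Nat.dvd_sub_iff_left h dvd_rfl]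
    simp [h, h0, hd]
  · have : m ∣ n ↔ n = 0 := ⟨fun hd => Nat.eq_zero_of_dvd_of_lt hd (by omega), by rintro rfl; simp⟩
    simp [h, this]

lemma evalsTo_geomSeries {m : ℕ} (hm : 0 < m) {q : ℂ} (hq : ‖q‖ < 1) :
    EvalsTo (geomSeries m) q (1 - q ^ m)⁻¹ := by
  have hinj : Function.Injective (fun j : ℕ => m * j) := fun a b h => Nat.eq_of_mul_eq_mul_left hm h
  have hqm : ‖q ^ m‖ < 1 := by rw [norm_pow]; exact pow_lt_one₀ (norm_nonneg _) hq hm.ne'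
  have hz : ∀ n, n ∉ Set.range (fun j : ℕ => m * j) → coeff n (geomSeries m) * q ^ n = 0 := by
    intro n hn
    have : ¬ m ∣ n := by rintro ⟨j, rfl⟩; exact hn ⟨j, rfl⟩
    simp [geomSeries, this]
  have hc : (fun n => coeff n (geomSeries m) * q ^ n) ∘ (fun j : ℕ => m * j) =
      fun j => (q ^ m) ^ j := by
    ext j
    simp [geomSeries, pow_mul]
  refine ⟨?_, ?_⟩
  · rw [← hinj.summable_iff (fun n hn => by rw [hz n hn, norm_zero])]
    have := summable_norm_geometric_of_norm_lt_one hqm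
    convert! this using 2 with j
    exact congrArg norm (congrFun hc j)
  · have := hasSum_geometric_of_norm_lt_one hqm
    rw [← hc, hinj.hasSum_iff hz] at this
    exact this.tsum_eq

/-- The power series with coefficients `pleA A k n`. -/
noncomputable def pleSeries (A k : ℕ) : PowerSeries ℂ := PowerSeries.mk fun n => (pleA A k n : ℂ)

lemma pleSeries_succ {A k : ℕ} (hA : 0 < A) :
    pleSeries A (k + 1) = pleSeries A k * geomSeries (A * (k + 1)) := by
  have h : pleSeries A (k + 1) * (1 - X ^ (A * (k + 1))) = pleSeries A k := by
    ext n
    rw [mul_sub, mul_one, map_sub, coeff_mul_X_pow']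
    simp only [pleSeries, coeff_mk]
    rw [pleA_succ]
    by_cases hn : A * (k + 1) ≤ n
    · have := pexact_add_mul (k := k + 1) (n := n - A * (k + 1)) hA
      rw [Nat.sub_add_cancel hn] at this
      simp [hn, this]
    · simp [hn, pexact_eq_zero (not_le.1 hn)]
  rw [← h, mul_assoc, mul_comm (1 - _), geomSeries_mul (by positivity), mul_one]

open scoped PowerSeries.WithPiTopology in
lemma tsum_X_pow_mul {m : ℕ} (hm : 0 < m) :
    ∑' j : ℕ, (X : PowerSeries ℂ) ^ (m * j) = geomSeries m := by
  have h := PowerSeries.WithPiTopology.tsum_pow_mul_one_sub_of_constantCoeff_eq_zero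
    (f := (X : PowerSeries ℂ) ^ m) (by simp [hm.ne'])
  simp_rw [pow_mul]
  calc _ = (∑' j : ℕ, ((X : PowerSeries ℂ) ^ m) ^ j) * ((1 - X ^ m) * geomSeries m) := by
        rw [mul_comm (1 - _), geomSeries_mul hm, mul_one]
    _ = _ := by rw [← mul_assoc, h, one_mul]

open scoped PowerSeries.WithPiTopology in
lemma mk_card_restricted_eq_prod (A N : ℕ) :
    (PowerSeries.mk fun n => ((Nat.Partition.restricted n (fun i => i ≤ N ∧ ¬ A ∣ i)).card : ℂ)) =
      ∏ i ∈ (Finset.range N).filter (fun i => ¬ A ∣ i + 1), geomSeries (i + 1) := by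
  refine (Nat.Partition.hasProd_powerSeriesMk_card_restricted ℂ (fun i => i ≤ N ∧ ¬ A ∣ i)).unique ?_
  have : ∏ i ∈ (Finset.range N).filter (fun i => ¬ A ∣ i + 1), geomSeries (i + 1) =
      ∏ i ∈ Finset.range N, if i + 1 ≤ N ∧ ¬ A ∣ i + 1 then
        ∑' j : ℕ, (X : PowerSeries ℂ) ^ ((i + 1) * j) else 1 := by
    rw [Finset.prod_filter]
    refine Finset.prod_congr rfl fun i hi => ?_
    have hi' := Finset.mem_range.1 hi
    rw [tsum_X_pow_mul (by omega)]
    have : i + 1 ≤ N := by omega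
    simp only [this, true_and]
  rw [this]
  refine hasProd_prod_of_ne_finset_one fun i hi => ?_
  have : ¬ (i + 1 ≤ N) := by simpa using hi
  simp [this]

end GeneratingFunctions

section EulerProduct

open PowerSeries Filter Topology

/-- Euler's product `∏ (1 - q ^ n)`. -/
noncomputable def eulerProd (q : ℂ) : ℂ := ∏' n : ℕ, (1 - q ^ (n + 1))

lemma one_sub_pow_ne_zero {q : ℂ} (hq : ‖q‖ < 1) {m : ℕ} (hm : m ≠ 0) : 1 - q ^ m ≠ 0 := by
  intro h
  have h1 : ‖q ^ m‖ < 1 := by rw [norm_pow]; exact pow_lt_one₀ (norm_nonneg _) hq hm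
  rw [← sub_eq_zero.1 h, norm_one] at h1
  exact lt_irrefl _ h1

lemma tendsto_prod_eulerProd {q : ℂ} (hq : ‖q‖ < 1) :
    Tendsto (fun N => ∏ i ∈ Finset.range N, (1 - q ^ (i + 1))) atTop (𝓝 (eulerProd q)) :=
  (ModularForm.multipliable_one_sub_pow hq).hasProd.tendsto_prod_nat

lemma eulerProd_ne_zero {q : ℂ} (hq : ‖q‖ < 1) : eulerProd q ≠ 0 := by
  refine tprod_one_add_ne_zero_of_summable (f := fun n : ℕ => -q ^ (n + 1)) (fun i => ?_) ?_
  · simpa [← sub_eq_add_neg] using one_sub_pow_ne_zero hq (Nat.succ_ne_zero i)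
  · simpa using (summable_nat_add_iff 1).mpr (summable_geometric_of_lt_one (norm_nonneg _) hq)

lemma norm_pow_lt_one {q : ℂ} (hq : ‖q‖ < 1) {A : ℕ} (hA : 0 < A) : ‖q ^ A‖ < 1 := by
  rw [norm_pow]; exact pow_lt_one₀ (norm_nonneg _) hq hA.ne'

lemma prod_range_mul_filter {A : ℕ} (hA : 0 < A) (M : ℕ) {q : ℂ} (hq : ‖q‖ < 1) :
    ∏ i ∈ (Finset.range (A * M)).filter (fun i => ¬ A ∣ i + 1), (1 - q ^ (i + 1))⁻¹ =
      (∏ j ∈ Finset.range M, (1 - (q ^ A) ^ (j + 1))) /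
        ∏ i ∈ Finset.range (A * M), (1 - q ^ (i + 1)) := by
  have hd : ∏ i ∈ (Finset.range (A * M)).filter (fun i => A ∣ i + 1), (1 - q ^ (i + 1)) =
      ∏ j ∈ Finset.range M, (1 - (q ^ A) ^ (j + 1)) := by
    symm
    refine Finset.prod_bij (fun j _ => A * (j + 1) - 1) ?_ ?_ ?_ ?_
    · intro j hj
      have hj' := Finset.mem_range.1 hj
      have h1 : A * (j + 1) ≤ A * M := Nat.mul_le_mul_left _ hj'
      have h2 : 0 < A * (j + 1) := by positivity
      have h3 : A * (j + 1) - 1 + 1 = A * (j + 1) := by omega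
      simp only [Finset.mem_filter, Finset.mem_range, h3, dvd_mul_right, and_true]
      omega
    · intro a _ b _ hab
      have h2 : 0 < A * (a + 1) := by positivity
      have h3 : 0 < A * (b + 1) := by positivity
      have : A * (a + 1) = A * (b + 1) := by omega
      have := Nat.eq_of_mul_eq_mul_left hA this
      omega
    · intro i hi
      simp only [Finset.mem_filter, Finset.mem_range] at hi
      obtain ⟨h1, c, hc⟩ := hi
      have hc0 : c ≠ 0 := by rintro rfl; omega
      refine ⟨c - 1, ?_, ?_⟩
      · rw [Finset.mem_range]
        have : A * c ≤ A * M := by omega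
        have := Nat.le_of_mul_le_mul_left this hA
        omega
      · rw [Nat.sub_add_cancel (Nat.pos_of_ne_zero hc0), ← hc]
        rfl
    · intro j _
      have h2 : 0 < A * (j + 1) := by positivity
      rw [Nat.sub_add_cancel h2, pow_mul]
  rw [← hd, ← Finset.prod_filter_mul_prod_filter_not (Finset.range (A * M)) (fun i => A ∣ i + 1)]
  rw [div_mul_eq_div_div, div_self, one_div, Finset.prod_inv_distrib]
  exact Finset.prod_ne_zero_iff.2 fun i _ => one_sub_pow_ne_zero hq (Nat.succ_ne_zero i)

lemma tendsto_prod_not_dvd {A : ℕ} (hA : 0 < A) {q : ℂ} (hq : ‖q‖ < 1) :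
    Tendsto (fun M => ∏ i ∈ (Finset.range (A * M)).filter (fun i => ¬ A ∣ i + 1),
      (1 - q ^ (i + 1))⁻¹) atTop (𝓝 (eulerProd (q ^ A) / eulerProd q)) := by
  simp only [prod_range_mul_filter hA _ hq]
  refine (tendsto_prod_eulerProd (norm_pow_lt_one hq hA)).div ?_ (eulerProd_ne_zero hq)
  exact (tendsto_prod_eulerProd hq).comp (tendsto_id.const_mul_atTop' hA)

lemma card_restricted_le (A N n : ℕ) :
    (Nat.Partition.restricted n (fun i => i ≤ N ∧ ¬ A ∣ i)).card ≤ pleA A 0 n := by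
  rw [pleA_zero_eq_preg]
  refine Finset.card_le_card fun π hπ => ?_
  simp only [Nat.Partition.restricted, Finset.mem_filter, Finset.mem_univ, true_and] at hπ ⊢
  exact fun r hr => (hπ r hr).2

lemma card_restricted_eq {A N n : ℕ} (h : n ≤ N) :
    (Nat.Partition.restricted n (fun i => i ≤ N ∧ ¬ A ∣ i)).card = pleA A 0 n := by
  refine (card_restricted_le A N n).antisymm ?_
  rw [pleA_zero_eq_preg]
  refine Finset.card_le_card fun π hπ => ?_
  simp only [Nat.Partition.restricted, Finset.mem_filter, Finset.mem_univ, true_and] at hπ ⊢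
  exact fun r hr => ⟨(Nat.Partition.le_of_mem_parts hr).trans h, hπ r hr⟩

lemma evalsTo_restricted (A N : ℕ) {q : ℂ} (hq : ‖q‖ < 1) :
    EvalsTo (PowerSeries.mk fun n =>
      ((Nat.Partition.restricted n (fun i => i ≤ N ∧ ¬ A ∣ i)).card : ℂ)) q
      (∏ i ∈ (Finset.range N).filter (fun i => ¬ A ∣ i + 1), (1 - q ^ (i + 1))⁻¹) := by
  rw [mk_card_restricted_eq_prod]
  exact EvalsTo.prod _ fun i _ => evalsTo_geomSeries (Nat.succ_pos i) hq

lemma summable_pleA_zero {A : ℕ} (hA : 0 < A) {r : ℝ} (hr0 : 0 ≤ r) (hr : r < 1) :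
    Summable fun n => (pleA A 0 n : ℝ) * r ^ n := by
  have hq : ‖(r : ℂ)‖ < 1 := by simpa [abs_of_nonneg hr0] using hr
  obtain ⟨C, hC⟩ := (tendsto_prod_not_dvd hA hq).norm.bddAbove_range
  refine summable_of_sum_range_le (c := C) (fun n => by positivity) fun M => ?_
  have hE := evalsTo_restricted A (A * M) hq
  have hE1 : Summable fun n =>
      ((Nat.Partition.restricted n (fun i => i ≤ A * M ∧ ¬ A ∣ i)).card : ℝ) * r ^ n := by
    refine hE.1.congr fun n => ?_
    simp [abs_of_nonneg hr0]
  have hE2 : ∑' n, ((Nat.Partition.restricted n (fun i => i ≤ A * M ∧ ¬ A ∣ i)).card : ℝ) * r ^ n =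
      ‖∏ i ∈ (Finset.range (A * M)).filter (fun i => ¬ A ∣ i + 1), (1 - (r : ℂ) ^ (i + 1))⁻¹‖ := by
    rw [← hE.2]
    have : ∀ n, coeff n (PowerSeries.mk fun n =>
        ((Nat.Partition.restricted n (fun i => i ≤ A * M ∧ ¬ A ∣ i)).card : ℂ)) * (r : ℂ) ^ n =
        ((((Nat.Partition.restricted n (fun i => i ≤ A * M ∧ ¬ A ∣ i)).card : ℝ) * r ^ n : ℝ) : ℂ) := by
      intro n
      simp
    simp only [this]
    rw [← Complex.ofReal_tsum, Complex.norm_real, Real.norm_of_nonneg]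
    exact tsum_nonneg fun n => by positivity
  calc ∑ n ∈ Finset.range M, (pleA A 0 n : ℝ) * r ^ n
      = ∑ n ∈ Finset.range M,
          ((Nat.Partition.restricted n (fun i => i ≤ A * M ∧ ¬ A ∣ i)).card : ℝ) * r ^ n := by
        refine Finset.sum_congr rfl fun n hn => ?_
        have := Finset.mem_range.1 hn
        rw [card_restricted_eq (this.le.trans (Nat.le_mul_of_pos_left _ hA))]
    _ ≤ _ := hE1.sum_le_tsum _ fun n _ => by positivity
    _ ≤ C := by rw [hE2]; exact hC ⟨M, rfl⟩

lemma evalsTo_pleSeries_zero {A : ℕ} (hA : 0 < A) {q : ℂ} (hq : ‖q‖ < 1) :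
    EvalsTo (pleSeries A 0) q (eulerProd (q ^ A) / eulerProd q) := by
  have hs := summable_pleA_zero hA (norm_nonneg q) hq
  refine ⟨?_, ?_⟩
  · simpa [pleSeries] using hs
  · refine tendsto_nhds_unique ?_ (tendsto_prod_not_dvd hA hq)
    have : ∀ M, ∏ i ∈ (Finset.range (A * M)).filter (fun i => ¬ A ∣ i + 1), (1 - q ^ (i + 1))⁻¹ =
        ∑' n, ((Nat.Partition.restricted n (fun i => i ≤ A * M ∧ ¬ A ∣ i)).card : ℂ) * q ^ n := by
      intro M
      rw [← (evalsTo_restricted A (A * M) hq).2]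
      simp
    simp only [this]
    refine tendsto_tsum_of_dominated_convergence hs (fun n => ?_) (Eventually.of_forall fun M n => ?_)
    · refine tendsto_const_nhds.congr' ?_
      filter_upwards [eventually_ge_atTop n] with M hM
      rw [card_restricted_eq (hM.trans (Nat.le_mul_of_pos_left _ hA))]
      simp [pleSeries]
    · rw [norm_mul, norm_pow, Complex.norm_natCast]
      gcongr
      exact card_restricted_le A (A * M) n

/-- The closed form of the generating function of `pleA A k`, at `q = exp (-z)`. -/
noncomputable def pleFun (A k : ℕ) (z : ℂ) : ℂ :=
  eulerProd (Complex.exp (-z) ^ A) / eulerProd (Complex.exp (-z)) *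
    ∏ j ∈ Finset.range k, (1 - Complex.exp (-z) ^ (A * (j + 1)))⁻¹

lemma norm_exp_neg_lt_one {z : ℂ} (hz : 0 < z.re) : ‖Complex.exp (-z)‖ < 1 := by
  rw [Complex.norm_exp]; simpa using hz

lemma evalsTo_pleSeries {A : ℕ} (hA : 0 < A) (k : ℕ) {z : ℂ} (hz : 0 < z.re) :
    EvalsTo (pleSeries A k) (Complex.exp (-z)) (pleFun A k z) := by
  have hq := norm_exp_neg_lt_one hz
  induction k with
  | zero => simpa [pleFun] using evalsTo_pleSeries_zero hA hq
  | succ k ih =>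
    rw [pleSeries_succ hA]
    have := ih.mul (evalsTo_geomSeries (m := A * (k + 1)) (by positivity) hq)
    rwa [pleFun, mul_assoc, ← Finset.prod_range_succ] at this

end EulerProduct

section Cauchy

open PowerSeries Filter Topology MeasureTheory

lemma integral_exp_int_mul_I (d : ℤ) :
    ∫ y in (-Real.pi)..Real.pi, Complex.exp ((d : ℂ) * Complex.I * y) =
      if d = 0 then 2 * (Real.pi : ℂ) else 0 := by
  split_ifs with h
  · subst h
    simp
    ring
  · have hd : (d : ℂ) * Complex.I ≠ 0 := mul_ne_zero (by exact_mod_cast h) Complex.I_ne_zero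
    rw [integral_exp_mul_complex hd, div_eq_zero_iff, sub_eq_zero]
    left
    rw [Complex.exp_eq_exp_iff_exists_int]
    exact ⟨d, by push_cast; ring⟩

lemma pleA_eq_integral {A : ℕ} (hA : 0 < A) (k n : ℕ) {x : ℝ} (hx : 0 < x) :
    ∫ y in (-Real.pi)..Real.pi,
      pleFun A k (x + y * Complex.I) * Complex.exp (n * y * Complex.I) =
      2 * Real.pi * ((pleA A k n : ℂ) * Complex.exp (-(n * x))) := by
  have hre : ∀ y : ℝ, 0 < ((x : ℂ) + y * Complex.I).re := by intro y; simpa using hx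
  have hexp : ∀ (m : ℕ) (y : ℝ), Complex.exp (-((x : ℂ) + y * Complex.I)) ^ m *
      Complex.exp (n * y * Complex.I) =
      Complex.exp (-(m * x)) * Complex.exp ((((n : ℤ) - (m : ℤ) : ℤ) : ℂ) * Complex.I * y) := by
    intro m y
    rw [← Complex.exp_nat_mul, ← Complex.exp_add, ← Complex.exp_add]
    congr 1
    push_cast
    ring
  have hsum : Summable fun m : ℕ => ‖(pleA A k m : ℂ) * Complex.exp (-(m * x))‖ := by
    have := (evalsTo_pleSeries hA k (z := x) (by simpa using hx)).1
    refine this.congr fun m => ?_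
    rw [pleSeries, coeff_mk, ← Complex.exp_nat_mul]
    congr 3
    ring
  have key := intervalIntegral.hasSum_integral_of_dominated_convergence (μ := volume)
    (a := -Real.pi) (b := Real.pi)
    (F := fun (m : ℕ) (y : ℝ) => ((pleA A k m : ℂ) * Complex.exp (-(m * x))) *
      Complex.exp ((((n : ℤ) - (m : ℤ) : ℤ) : ℂ) * Complex.I * y))
    (f := fun y : ℝ => pleFun A k (x + y * Complex.I) * Complex.exp (n * y * Complex.I))
    (bound := fun m _ => ‖(pleA A k m : ℂ) * Complex.exp (-(m * x))‖)
    (fun m => by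
      apply Continuous.aestronglyMeasurable
      fun_prop)
    (fun m => Eventually.of_forall fun y _ => by
      rw [norm_mul, Complex.norm_exp]
      simp)
    (Eventually.of_forall fun y _ => hsum)
    (by simp)
    (Eventually.of_forall fun y _ => by
      have hE := evalsTo_pleSeries hA k (hre y)
      have h1 := hE.1.of_norm.hasSum
      rw [hE.2] at h1
      have h2 := h1.mul_right (Complex.exp (n * y * Complex.I))
      have hm : ∀ m : ℕ, (pleSeries A k).coeff m * Complex.exp (-((x : ℂ) + y * Complex.I)) ^ m *
          Complex.exp (n * y * Complex.I) = ((pleA A k m : ℂ) * Complex.exp (-(m * x))) *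
          Complex.exp ((((n : ℤ) - (m : ℤ) : ℤ) : ℂ) * Complex.I * y) := fun m => by
        rw [pleSeries, coeff_mk, mul_assoc, hexp, ← mul_assoc]
      simpa only [hm] using h2)
  rw [← key.tsum_eq]
  simp only [intervalIntegral.integral_const_mul, integral_exp_int_mul_I]
  rw [tsum_eq_single n]
  · simp
    ring
  · intro m hm
    have : (n : ℤ) - (m : ℤ) ≠ 0 := by omega
    simp [this]

end Cauchy

section Modular

open Filter Topology

lemma eta_eq_eulerProd (z : ℂ) :
    ModularForm.eta (Complex.I * z / (2 * Real.pi)) =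
      Complex.exp (-z / 24) * eulerProd (Complex.exp (-z)) := by
  have hpi : (Real.pi : ℂ) ≠ 0 := by exact_mod_cast Real.pi_ne_zero
  have h : ∀ h : ℝ, h ≠ 0 → Function.Periodic.qParam h (Complex.I * z / (2 * Real.pi)) =
      Complex.exp (-z / h) := by
    intro h hh
    have hh' : (h : ℂ) ≠ 0 := by exact_mod_cast hh
    rw [Function.Periodic.qParam]
    congr 1
    field_simp
    linear_combination z * Complex.I_sq
  rw [ModularForm.eta, eulerProd]
  simp only [ModularForm.eta_q, h 1 one_ne_zero, h 24 (by norm_num)]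
  simp

lemma eulerProd_transform {z : ℂ} (hz : 0 < z.re) :
    Complex.exp (-(4 * Real.pi ^ 2 / z) / 24) * eulerProd (Complex.exp (-(4 * Real.pi ^ 2 / z))) =
      (Complex.sqrt Complex.I)⁻¹ * (Complex.sqrt (Complex.I * z / (2 * Real.pi)) *
        (Complex.exp (-z / 24) * eulerProd (Complex.exp (-z)))) := by
  have hpi : (Real.pi : ℂ) ≠ 0 := by exact_mod_cast Real.pi_ne_zero
  have hz0 : z ≠ 0 := by rintro rfl; simp at hz
  have him : Complex.I * z / (2 * Real.pi) ∈ UpperHalfPlane.upperHalfPlaneSet := by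
    have : Complex.I * z / (2 * Real.pi) = ((2 * Real.pi)⁻¹ : ℝ) * (Complex.I * z) := by
      push_cast; field_simp
    change 0 < (Complex.I * z / (2 * Real.pi)).im
    rw [this, Complex.im_ofReal_mul]
    have := Real.pi_pos
    simp only [Complex.I_mul_im]
    positivity
  have h := ModularForm.eta_comp_eq_csqrt_I_inv him
  simp only [Function.comp, Pi.smul_apply, Pi.mul_apply, smul_eq_mul] at h
  rw [eta_eq_eulerProd] at h
  rw [← h, ← eta_eq_eulerProd]
  congr 1
  field_simp
  linear_combination 4 * Complex.I_sq

lemma eulerProd_div_eq {A : ℕ} (hA : 0 < A) {z : ℂ} (hz : 0 < z.re) :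
    eulerProd (Complex.exp (-z) ^ A) / eulerProd (Complex.exp (-z)) =
      (Real.sqrt A : ℂ)⁻¹ * Complex.exp ((A - 1) * z / 24) *
        Complex.exp (Real.pi ^ 2 / 6 * (1 - 1 / A) / z) *
        (eulerProd (Complex.exp (-(4 * Real.pi ^ 2 / (A * z)))) /
          eulerProd (Complex.exp (-(4 * Real.pi ^ 2 / z)))) := by
  have hpi : (Real.pi : ℂ) ≠ 0 := by exact_mod_cast Real.pi_ne_zero
  have hz0 : z ≠ 0 := by rintro rfl; simp at hz
  have hA0 : (A : ℂ) ≠ 0 := by exact_mod_cast hA.ne'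
  have hAz : 0 < ((A : ℂ) * z).re := by
    rw [← Complex.ofReal_natCast, Complex.re_ofReal_mul]
    positivity
  have hzi : 0 < (4 * (Real.pi : ℂ) ^ 2 / z).re := by
    rw [Complex.div_re]
    have := Real.pi_pos
    have h2 : 0 < Complex.normSq z := Complex.normSq_pos.2 hz0
    have h3 : (4 * (Real.pi : ℂ) ^ 2) = ((4 * Real.pi ^ 2 : ℝ) : ℂ) := by push_cast; ring
    rw [h3, Complex.ofReal_re, Complex.ofReal_im]
    simp only [zero_mul, zero_div, add_zero]
    positivity
  have h1 := eulerProd_transform hz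
  have h2 := eulerProd_transform hAz
  have hs : Complex.sqrt (Complex.I * (A * z) / (2 * Real.pi)) =
      Real.sqrt A * Complex.sqrt (Complex.I * z / (2 * Real.pi)) := by
    have hA' : (0 : ℝ) < A := by exact_mod_cast hA
    have hw : Complex.I * z / (2 * Real.pi) ≠ 0 := by
      simp [hpi, hz0]
    have e : Complex.I * (A * z) / (2 * Real.pi) = ((A : ℝ) : ℂ) * (Complex.I * z / (2 * Real.pi)) := by
      push_cast; ring
    rw [e, sqrt_eq_exp hw, sqrt_eq_exp (mul_ne_zero (by simpa using hA0) hw),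
      Complex.log_ofReal_mul hA' hw, Real.sqrt_eq_rpow, Real.rpow_def_of_pos hA', Complex.ofReal_exp,
      ← Complex.exp_add]
    congr 1
    push_cast
    ring
  have hq : Complex.exp (-z) ^ A = Complex.exp (-(A * z)) := by
    rw [← Complex.exp_nat_mul]; congr 1; ring
  rw [hs] at h2
  rw [hq]
  have e1 := eulerProd_ne_zero (norm_exp_neg_lt_one hz)
  have e2 := eulerProd_ne_zero (norm_exp_neg_lt_one hzi)
  have hsA : (Real.sqrt A : ℂ) ≠ 0 := by
    exact_mod_cast (Real.sqrt_pos.2 (by exact_mod_cast hA : (0 : ℝ) < A)).ne'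
  have x1 : Complex.exp ((A - 1) * z / 24) * Complex.exp (-(A * z) / 24) = Complex.exp (-z / 24) := by
    rw [← Complex.exp_add]; congr 1; ring
  have x2 : Complex.exp (Real.pi ^ 2 / 6 * (1 - 1 / A) / z) *
      Complex.exp (-(4 * Real.pi ^ 2 / z) / 24) = Complex.exp (-(4 * Real.pi ^ 2 / (A * z)) / 24) := by
    rw [← Complex.exp_add]; congr 1; field_simp; ring
  set a1 := Complex.exp (-z / 24)
  set a2 := Complex.exp (-(A * z) / 24) with ha2
  set b1 := Complex.exp (-(4 * Real.pi ^ 2 / z) / 24) with hb1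
  set b2 := Complex.exp (-(4 * Real.pi ^ 2 / (A * z)) / 24)
  set E1 := eulerProd (Complex.exp (-z))
  set E2 := eulerProd (Complex.exp (-(A * z)))
  set D1 := eulerProd (Complex.exp (-(4 * Real.pi ^ 2 / z)))
  set D2 := eulerProd (Complex.exp (-(4 * Real.pi ^ 2 / (A * z))))
  set S := Complex.sqrt (Complex.I * z / (2 * Real.pi))
  set T := (Complex.sqrt Complex.I)⁻¹
  have hb1' : b1 ≠ 0 := Complex.exp_ne_zero _
  have ha2' : a2 ≠ 0 := Complex.exp_ne_zero _
  have hTS : T * S * a1 * E1 ≠ 0 := by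
    have : T * S * a1 * E1 = b1 * D1 := by rw [h1]; ring
    rw [this]
    exact mul_ne_zero hb1' e2
  rw [div_eq_iff e1]
  have hD1 : D1 = T * (S * (a1 * E1)) / b1 := by rw [eq_div_iff hb1', ← h1]; ring
  have hD2 : D2 * b2 = T * (Real.sqrt A * S * (a2 * E2)) := by rw [← h2]; ring
  have hX1 : Complex.exp ((A - 1) * z / 24) = a1 / a2 := by rw [eq_div_iff ha2', x1]
  have hX2 : Complex.exp (Real.pi ^ 2 / 6 * (1 - 1 / A) / z) = b2 / b1 := by rw [eq_div_iff hb1', x2]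
  rw [hX1, hX2, hD1]
  have hT : T ≠ 0 := by rintro h; simp [h] at hTS
  have hS : S ≠ 0 := by rintro h; simp [h] at hTS
  have ha1 : a1 ≠ 0 := by rintro h; simp [h] at hTS
  field_simp
  linear_combination -hD2

lemma tendsto_eulerProd_zero : Tendsto eulerProd (𝓝 0) (𝓝 1) := by
  have := ((ModularForm.differentiableOn_tprod_one_sub_pow).continuousOn.continuousAt
    (Metric.ball_mem_nhds (0 : ℂ) one_pos)).tendsto
  have h1 : eulerProd 0 = 1 := by simp [eulerProd]
  rw [← h1]
  exact this

end Modular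

section MinorArc

open Filter Topology

lemma norm_sq_one_sub_exp (u θ : ℝ) :
    ‖1 - Complex.exp (-(u + θ * Complex.I))‖ ^ 2 =
      (1 - Real.exp (-u)) ^ 2 + 4 * Real.exp (-u) * Real.sin (θ / 2) ^ 2 := by
  have h1 : Complex.exp (-(u + θ * Complex.I)) =
      (Real.exp (-u) : ℂ) * (Real.cos θ - Real.sin θ * Complex.I) := by
    rw [neg_add, Complex.exp_add, Complex.ofReal_exp, Complex.ofReal_neg, ← neg_mul,
      Complex.exp_mul_I, Complex.cos_neg, Complex.sin_neg, Complex.ofReal_cos, Complex.ofReal_sin]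
    ring
  have hc : Real.cos θ = 1 - 2 * Real.sin (θ / 2) ^ 2 := by
    have := Real.cos_two_mul (θ / 2)
    rw [show 2 * (θ / 2) = θ by ring] at this
    have h2 := Real.sin_sq_add_cos_sq (θ / 2)
    linarith
  rw [h1, ← Complex.normSq_eq_norm_sq, Complex.normSq_apply]
  simp only [Complex.sub_re, Complex.sub_im, Complex.one_re, Complex.one_im,
    Complex.re_ofReal_mul, Complex.im_ofReal_mul, Complex.ofReal_re, Complex.ofReal_im,
    Complex.I_re, Complex.I_im]
  have h3 := Real.sin_sq_add_cos_sq θ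
  linear_combination (Real.exp (-u)) ^ 2 * h3 - 2 * Real.exp (-u) * hc

lemma one_sub_exp_le_norm {u : ℝ} (θ : ℝ) :
    1 - Real.exp (-u) ≤ ‖1 - Complex.exp (-(u + θ * Complex.I))‖ := by
  apply le_of_abs_le
  rw [← abs_norm (1 - _), ← sq_le_sq, norm_sq_one_sub_exp]
  have := Real.exp_pos (-u)
  nlinarith [mul_nonneg this.le (sq_nonneg (Real.sin (θ / 2)))]

lemma exp_div_seventeen_le {v : ℝ} (h0 : 0 ≤ v) (h16 : v ≤ 16) :
    Real.exp (v / 17) ≤ 1 + v := by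
  have h1 : 1 - v / 17 ≤ Real.exp (-(v / 17)) := by
    have := Real.add_one_le_exp (-(v / 17))
    linarith
  rw [Real.exp_neg] at h1
  have h2 := Real.exp_pos (v / 17)
  have h3 : (1 - v / 17) * Real.exp (v / 17) ≤ 1 := by
    calc _ ≤ (Real.exp (v / 17))⁻¹ * Real.exp (v / 17) := by gcongr
      _ = 1 := inv_mul_cancel₀ h2.ne'
  have h4 : 1 ≤ (1 + v) * (1 - v / 17) := by nlinarith
  have h5 : 0 < 1 - v / 17 := by linarith
  nlinarith

lemma one_sub_exp_le_mul_norm {u v θ : ℝ} (hu : 0 < u) (hu1 : u ≤ 1) (hv : 0 ≤ v) (hv16 : v ≤ 16)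
    (h : v * u ^ 2 ≤ Real.sin (θ / 2) ^ 2) :
    1 - Real.exp (-u) ≤
      Real.exp (-(v / 34)) * ‖1 - Complex.exp (-(u + θ * Complex.I))‖ := by
  have h0 : 0 < 1 - Real.exp (-u) := by
    have : Real.exp (-u) < 1 := by rw [Real.exp_lt_one_iff]; linarith
    linarith
  have h1 : 1 - Real.exp (-u) ≤ u := by
    have := Real.add_one_le_exp (-u)
    linarith
  have h2 : 1 ≤ 4 * Real.exp (-u) := by
    have h3 : Real.exp (-1) ≤ Real.exp (-u) := Real.exp_le_exp.2 (by linarith)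
    have h4 : Real.exp 1 < 4 := by have := Real.exp_one_lt_d9; linarith
    rw [Real.exp_neg] at h3
    have : (4 : ℝ)⁻¹ < (Real.exp 1)⁻¹ := inv_strictAnti₀ (Real.exp_pos 1) h4
    linarith
  have h5 : (1 - Real.exp (-u)) ^ 2 * (1 + v) ≤
      ‖1 - Complex.exp (-(u + θ * Complex.I))‖ ^ 2 := by
    rw [norm_sq_one_sub_exp]
    have h6 : (1 - Real.exp (-u)) ^ 2 ≤ u ^ 2 := by gcongr
    have h7 : v * (1 - Real.exp (-u)) ^ 2 ≤ Real.sin (θ / 2) ^ 2 :=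
      (mul_le_mul_of_nonneg_left h6 hv).trans h
    nlinarith [sq_nonneg (Real.sin (θ / 2))]
  have h6 : ((1 - Real.exp (-u)) * Real.exp (v / 34)) ^ 2 ≤
      ‖1 - Complex.exp (-(u + θ * Complex.I))‖ ^ 2 := by
    refine le_trans ?_ h5
    rw [mul_pow, ← Real.exp_nat_mul]
    have : ((2 : ℕ) : ℝ) * (v / 34) = v / 17 := by push_cast; ring
    rw [this]
    have := exp_div_seventeen_le hv hv16
    gcongr
  have h7 := abs_le_of_sq_le_sq h6 (norm_nonneg _)
  rw [Real.exp_neg (v / 34), inv_mul_eq_div, le_div_iff₀ (Real.exp_pos _)]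
  exact (le_abs_self _).trans h7

lemma exp_neg_pow_eq (x y : ℝ) (m : ℕ) :
    Complex.exp (-((x : ℂ) + y * Complex.I)) ^ m =
      Complex.exp (-(((m * x : ℝ) : ℂ) + (m * y : ℝ) * Complex.I)) := by
  rw [← Complex.exp_nat_mul]
  congr 1
  push_cast
  ring

lemma norm_one_sub_exp_ofReal {u : ℝ} (hu : 0 ≤ u) :
    ‖1 - Complex.exp (-(u : ℂ))‖ = 1 - Real.exp (-u) := by
  have : Real.exp (-u) ≤ 1 := Real.exp_le_one_iff.2 (by linarith)
  rw [← Complex.ofReal_neg, ← Complex.ofReal_exp, ← Complex.ofReal_one, ← Complex.ofReal_sub,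
    Complex.norm_real, Real.norm_of_nonneg (by linarith)]

lemma norm_inv_one_sub_pow_le {x y c : ℝ} {m : ℕ} (hx : 0 < x) (hm : m ≠ 0)
    (h : 1 - Real.exp (-(m * x)) ≤
      c * ‖1 - Complex.exp (-(((m * x : ℝ) : ℂ) + (m * y : ℝ) * Complex.I))‖) :
    ‖(1 - Complex.exp (-((x : ℂ) + y * Complex.I)) ^ m)⁻¹‖ ≤
      c * ‖(1 - Complex.exp (-(x : ℂ)) ^ m)⁻¹‖ := by
  have hre : 0 < ((x : ℂ) + y * Complex.I).re := by simpa using hx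
  have hne := one_sub_pow_ne_zero (norm_exp_neg_lt_one hre) hm
  have hmx : 0 < m * x := by positivity
  have e0 : Complex.exp (-(x : ℂ)) ^ m = Complex.exp (-((m * x : ℝ) : ℂ)) := by
    rw [← Complex.exp_nat_mul]
    congr 1
    push_cast
    ring
  rw [norm_inv, norm_inv, e0, norm_one_sub_exp_ofReal hmx.le]
  rw [← exp_neg_pow_eq] at h
  have h1 : 0 < 1 - Real.exp (-(m * x)) := by
    have : Real.exp (-(m * x)) < 1 := by rw [Real.exp_lt_one_iff]; linarith
    linarith
  have h2 : 0 < ‖1 - Complex.exp (-((x : ℂ) + y * Complex.I)) ^ m‖ := norm_pos_iff.2 hne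
  rw [← div_eq_mul_inv, le_div_iff₀ h1, inv_mul_le_iff₀ h2]
  linarith

lemma norm_inv_one_sub_pow_le_self {x : ℝ} (y : ℝ) {m : ℕ} (hx : 0 < x) (hm : m ≠ 0) :
    ‖(1 - Complex.exp (-((x : ℂ) + y * Complex.I)) ^ m)⁻¹‖ ≤
      ‖(1 - Complex.exp (-(x : ℂ)) ^ m)⁻¹‖ := by
  have := norm_inv_one_sub_pow_le (x := x) (y := y) (c := 1) hx hm (by
    rw [one_mul]; exact one_sub_exp_le_norm _)
  simpa using this

/-- Comparing `pleFun` on a vertical line with its value on the real axis, gaining an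
exponential factor from the first `J` parts congruent to `1` modulo `A`. -/
lemma norm_pleFun_le {A : ℕ} (hA : 2 ≤ A) (k : ℕ) {x y : ℝ} (hx : 0 < x) (J : ℕ) (v : ℕ → ℝ)
    (hJ : A * J * x ≤ 1) (hv : ∀ j < J, 0 ≤ v j) (hv16 : ∀ j < J, v j ≤ 16)
    (h : ∀ j < J, v j * ((A * j + 1) * x) ^ 2 ≤ Real.sin ((A * j + 1) * y / 2) ^ 2) :
    ‖pleFun A k (x + y * Complex.I)‖ ≤
      ‖pleFun A k x‖ * Real.exp (-((∑ j ∈ range J, v j) / 34)) := by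
  have hA0 : 0 < A := by omega
  have hre : 0 < ((x : ℂ) + y * Complex.I).re := by simpa using hx
  have hre0 : 0 < ((x : ℂ)).re := by simpa using hx
  have t1 := (tendsto_prod_not_dvd hA0 (norm_exp_neg_lt_one hre)).norm
  have t2 := ((tendsto_prod_not_dvd hA0 (norm_exp_neg_lt_one hre0)).norm).mul_const
    (Real.exp (-((∑ j ∈ range J, v j) / 34)))
  have hle := le_of_tendsto_of_tendsto t1 t2 (by
    filter_upwards [eventually_ge_atTop J] with M hM
    set F := (range (A * M)).filter (fun i => ¬ A ∣ i + 1) with hF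
    have hSF : (range J).image (fun j => A * j) ⊆ F := by
      intro i hi
      obtain ⟨j, hj, rfl⟩ := mem_image.1 hi
      rw [mem_range] at hj
      rw [hF, mem_filter, mem_range]
      refine ⟨by gcongr; omega, fun hd => ?_⟩
      have := (Nat.dvd_add_right (Dvd.intro j rfl)).1 hd
      have := Nat.le_of_dvd one_pos this
      omega
    have hinj : Set.InjOn (fun j : ℕ => A * j) (range J : Set ℕ) := fun a _ b _ hab =>
      Nat.eq_of_mul_eq_mul_left hA0 hab
    rw [norm_prod, norm_prod, ← prod_sdiff hSF, ← prod_sdiff hSF, mul_assoc]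
    refine mul_le_mul ?_ ?_ (prod_nonneg fun _ _ => norm_nonneg _)
      (prod_nonneg fun _ _ => norm_nonneg _)
    · exact prod_le_prod (fun _ _ => norm_nonneg _) fun i _ =>
        norm_inv_one_sub_pow_le_self y hx (Nat.succ_ne_zero i)
    · rw [prod_image hinj, prod_image hinj, sum_div, ← sum_neg_distrib, Real.exp_sum,
        ← prod_mul_distrib]
      refine prod_le_prod (fun _ _ => norm_nonneg _) fun j hj => ?_
      rw [mem_range] at hj
      rw [mul_comm ‖_‖ (Real.exp _)]
      refine norm_inv_one_sub_pow_le hx (Nat.succ_ne_zero _) ?_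
      have hj1 : (j : ℝ) + 1 ≤ J := by exact_mod_cast hj
      have hA1 : (1 : ℝ) ≤ A := by exact_mod_cast hA0
      have hu1 : ((A * j + 1 : ℕ) : ℝ) * x ≤ 1 := by
        refine le_trans ?_ hJ
        push_cast
        gcongr
        nlinarith
      refine one_sub_exp_le_mul_norm (by positivity) hu1 (hv j hj) (hv16 j hj) ?_
      push_cast
      exact h j hj)
  rw [pleFun, pleFun, norm_mul, norm_mul, mul_right_comm]
  refine mul_le_mul hle ?_ (norm_nonneg _) (by positivity)
  rw [norm_prod, norm_prod]
  exact prod_le_prod (fun _ _ => norm_nonneg _) fun j _ =>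
    norm_inv_one_sub_pow_le_self y hx (by positivity)

lemma abs_sin_mul_sum_cos_le (a b : ℝ) (J : ℕ) :
    |Real.sin (a / 2) * ∑ j ∈ range J, Real.cos (a * j + b)| ≤ 1 := by
  have h : 2 * (Real.sin (a / 2) * ∑ j ∈ range J, Real.cos (a * j + b)) =
      Real.sin (a * J + b - a / 2) - Real.sin (b - a / 2) := by
    induction J with
    | zero => simp
    | succ J ih =>
      rw [sum_range_succ, mul_add, mul_add, ih]
      have e1 : a * ((J + 1 : ℕ) : ℝ) + b - a / 2 = (a * J + b) + a / 2 := by push_cast; ring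
      rw [e1, Real.sin_add, Real.sin_sub (a * J + b)]
      ring
  have h1 := Real.abs_sin_le_one (a * J + b - a / 2)
  have h2 := Real.abs_sin_le_one (b - a / 2)
  rw [abs_le] at *
  constructor <;> linarith [h1.1, h1.2, h2.1, h2.2]

lemma abs_sin_nat_mul_le (w : ℝ) (j : ℕ) : |Real.sin (j * w)| ≤ j * |Real.sin w| := by
  induction j with
  | zero => simp
  | succ j ih =>
    push_cast
    rw [add_mul, add_mul, one_mul, one_mul, Real.sin_add]
    calc _ ≤ |Real.sin (j * w)| * |Real.cos w| + |Real.cos (j * w)| * |Real.sin w| := by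
          rw [← abs_mul, ← abs_mul]; exact abs_add_le _ _
      _ ≤ |Real.sin (j * w)| * 1 + 1 * |Real.sin w| := by
          gcongr
          · exact Real.abs_cos_le_one _
          · exact Real.abs_cos_le_one _
      _ ≤ _ := by linarith

lemma abs_sin_le_abs_sin_add (a b : ℝ) : |Real.sin b| ≤ |Real.sin (a + b)| + |Real.sin a| := by
  have : Real.sin b = Real.sin (a + b) * Real.cos a - Real.cos (a + b) * Real.sin a := by
    rw [← Real.sin_sub]; congr 1; ring
  rw [this]
  calc _ ≤ |Real.sin (a + b)| * |Real.cos a| + |Real.cos (a + b)| * |Real.sin a| := by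
        rw [← abs_mul, ← abs_mul]; exact abs_sub _ _
    _ ≤ |Real.sin (a + b)| * 1 + 1 * |Real.sin a| := by
        gcongr
        · exact Real.abs_cos_le_one _
        · exact Real.abs_cos_le_one _
    _ = _ := by ring

lemma half_le_floor {t : ℝ} (ht : 1 ≤ t) : t / 2 ≤ (⌊t⌋₊ : ℝ) := by
  have h1 := Nat.lt_floor_add_one t
  have h2 : (1 : ℝ) ≤ ⌊t⌋₊ := by exact_mod_cast Nat.floor_pos.2 ht
  linarith

end MinorArc

section MinorArcBound

open Filter Topology

lemma norm_pleFun_le_near {A : ℕ} (hA : 2 ≤ A) (k : ℕ) {x y : ℝ} (hx : 0 < x)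
    (hx1 : 8 * A ^ 2 * x ≤ 1) (hy : |y| ≤ 4 * Real.pi * x) :
    ‖pleFun A k (x + y * Complex.I)‖ ≤
      ‖pleFun A k x‖ * Real.exp (-(1 / (10000 * A ^ 4) * (y ^ 2 / x ^ 3))) := by
  have hA2 : (2 : ℝ) ≤ A := by exact_mod_cast hA
  have hApos : (0 : ℝ) < A := by linarith
  have hpi := Real.pi_pos
  have hpi4 := Real.pi_lt_d2
  have hf1 : (1 : ℝ) ≤ 1 / (4 * A * x) := by
    rw [le_div_iff₀ (by positivity)]
    nlinarith
  set J := ⌊1 / (4 * A * x)⌋₊ with hJ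
  have hJle : (J : ℝ) ≤ 1 / (4 * A * x) := Nat.floor_le (by positivity)
  have hJge : 1 / (4 * A * x) / 2 ≤ (J : ℝ) := half_le_floor hf1
  have hJ4 : A * J * x ≤ 1 / 4 := by
    rw [le_div_iff₀ (by positivity)] at hJle
    linarith
  have hv16 : y ^ 2 / (Real.pi ^ 2 * x ^ 2) ≤ 16 := by
    rw [div_le_iff₀ (by positivity)]
    calc y ^ 2 = |y| ^ 2 := (sq_abs y).symm
      _ ≤ (4 * Real.pi * x) ^ 2 := by gcongr
      _ = _ := by ring
  refine (norm_pleFun_le hA k hx J (fun _ => y ^ 2 / (Real.pi ^ 2 * x ^ 2)) (by linarith)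
    (fun _ _ => by positivity) (fun _ _ => hv16) fun j hj => ?_).trans ?_
  · have hj1 : (j : ℝ) + 1 ≤ J := by exact_mod_cast hj
    set m : ℝ := A * j + 1 with hm
    have hm0 : 0 < m := by positivity
    have hmJ : m * x ≤ 1 / 4 := by
      refine le_trans ?_ hJ4
      gcongr
      nlinarith
    have habs : |m * y / 2| ≤ Real.pi / 2 := by
      rw [abs_div, abs_mul, abs_of_pos hm0, abs_two]
      have : m * |y| ≤ m * (4 * Real.pi * x) := by gcongr
      nlinarith
    have hs := Real.mul_abs_le_abs_sin habs
    calc y ^ 2 / (Real.pi ^ 2 * x ^ 2) * (m * x) ^ 2 = (2 / Real.pi * |m * y / 2|) ^ 2 := by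
          rw [mul_pow (2 / Real.pi), sq_abs]; field_simp
      _ ≤ |Real.sin (m * y / 2)| ^ 2 := by gcongr
      _ = _ := sq_abs _
  · refine mul_le_mul_of_nonneg_left (Real.exp_le_exp.2 (neg_le_neg ?_)) (norm_nonneg _)
    rw [sum_const, card_range, nsmul_eq_mul]
    have h1 : 1 / (4 * A * x) / 2 * (y ^ 2 / (Real.pi ^ 2 * x ^ 2)) / 34 ≤
        J * (y ^ 2 / (Real.pi ^ 2 * x ^ 2)) / 34 := by gcongr
    refine le_trans ?_ h1
    have e : 1 / (4 * A * x) / 2 * (y ^ 2 / (Real.pi ^ 2 * x ^ 2)) / 34 =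
        1 / (272 * A * Real.pi ^ 2) * (y ^ 2 / x ^ 3) := by field_simp; ring
    rw [e]
    refine mul_le_mul_of_nonneg_right ?_ (by positivity)
    refine one_div_le_one_div_of_le (by positivity) ?_
    have : Real.pi ^ 2 ≤ 10 := by nlinarith
    have : (A : ℝ) ≤ A ^ 4 := by
      calc (A : ℝ) = A ^ 1 := by ring
        _ ≤ A ^ 4 := pow_le_pow_right₀ (by linarith) (by norm_num)
    calc 272 * A * Real.pi ^ 2 ≤ 272 * A ^ 4 * 10 := by gcongr
      _ ≤ _ := by nlinarith

lemma norm_pleFun_le_far {A : ℕ} (hA : 2 ≤ A) (k : ℕ) {x y : ℝ} (hx : 0 < x)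
    (hx1 : 8 * A ^ 2 * x ≤ 1) (hy : 4 * Real.pi * x < |y|) (hyp : |y| ≤ Real.pi) :
    ‖pleFun A k (x + y * Complex.I)‖ ≤
      ‖pleFun A k x‖ * Real.exp (-(1 / (10000 * A ^ 4) / x)) := by
  have hA2 : (2 : ℝ) ≤ A := by exact_mod_cast hA
  have hApos : (0 : ℝ) < A := by linarith
  have hpi := Real.pi_pos
  have hf1 : (1 : ℝ) ≤ 1 / (A * x) := by
    rw [le_div_iff₀ (by positivity)]
    nlinarith
  set J := ⌊1 / (A * x)⌋₊ with hJ
  have hJle : (J : ℝ) ≤ 1 / (A * x) := Nat.floor_le (by positivity)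
  have hJge : 1 / (A * x) / 2 ≤ (J : ℝ) := half_le_floor hf1
  have hJ0 : (0 : ℝ) < J := lt_of_lt_of_le (by positivity) hJge
  have hJ1 : A * J * x ≤ 1 := by
    rw [le_div_iff₀ (by positivity)] at hJle
    linarith
  have hu : ∀ {K j : ℕ}, A * (K : ℝ) * x ≤ 1 → j < K → ((A : ℝ) * j + 1) * x ≤ 1 := by
    intro K j hK hj
    have hj1 : (j : ℝ) + 1 ≤ K := by exact_mod_cast hj
    refine le_trans ?_ hK
    gcongr
    nlinarith
  have hAA : (A : ℝ) ≤ A ^ 4 := by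
    calc (A : ℝ) = A ^ 1 := by ring
      _ ≤ A ^ 4 := pow_le_pow_right₀ (by linarith) (by norm_num)
  by_cases hs : 2 / (J : ℝ) ≤ |Real.sin (A * y / 2)|
  · refine (norm_pleFun_le hA k hx J (fun j => Real.sin ((A * j + 1) * y / 2) ^ 2) hJ1
      (fun _ _ => by positivity) (fun _ _ => ?_) fun j hj => ?_).trans ?_
    · exact (Real.sin_sq_le_one _).trans (by norm_num)
    · have h1 := hu hJ1 hj
      calc _ ≤ Real.sin ((A * j + 1) * y / 2) ^ 2 * 1 ^ 2 := by gcongr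
        _ = _ := by ring
    · refine mul_le_mul_of_nonneg_left (Real.exp_le_exp.2 (neg_le_neg ?_)) (norm_nonneg _)
      have hcos := abs_sin_mul_sum_cos_le (A * y) y J
      rw [abs_mul] at hcos
      set Sg := ∑ j ∈ range J, Real.cos (A * y * j + y) with hSg
      have hsum : ∑ j ∈ range J, Real.sin ((A * j + 1) * y / 2) ^ 2 = J / 2 - Sg / 2 := by
        rw [hSg, sum_div, ← sub_eq_zero]
        have : (J : ℝ) / 2 = ∑ j ∈ range J, (1 / 2 : ℝ) := by simp; ring
        rw [this, ← sum_sub_distrib, ← sum_sub_distrib]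
        refine sum_eq_zero fun j _ => ?_
        have hc := Real.cos_two_mul (((A : ℝ) * j + 1) * y / 2)
        have h2 := Real.sin_sq_add_cos_sq (((A : ℝ) * j + 1) * y / 2)
        rw [show 2 * (((A : ℝ) * j + 1) * y / 2) = A * y * j + y by ring] at hc
        linarith
      have hSgle : |Sg| ≤ J / 2 := by
        have : 2 / (J : ℝ) * |Sg| ≤ 1 := le_trans (by gcongr) hcos
        rw [div_mul_eq_mul_div, div_le_one hJ0] at this
        linarith
      rw [hsum]
      have h3 := (abs_le.1 hSgle).2
      have h4 : 1 / (10000 * A ^ 4) / x ≤ 1 / (A * x) / 2 / 4 / 34 := by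
        rw [div_div, div_div, div_div, div_div]
        refine one_div_le_one_div_of_le (by positivity) ?_
        nlinarith [mul_le_mul_of_nonneg_right hAA hx.le]
      linarith
  · push Not at hs
    have hsA : 2 / (J : ℝ) ≤ 4 * A * x := by
      rw [div_le_iff₀ hJ0]
      have : 4 * A * x * (1 / (A * x) / 2) ≤ 4 * A * x * J := by gcongr
      refine le_trans (le_of_eq ?_) this
      field_simp
      norm_num
    have hyA : Real.pi / A < |y| := by
      by_contra hcon
      push Not at hcon
      have habs : |A * y / 2| ≤ Real.pi / 2 := by
        rw [abs_div, abs_mul, abs_of_pos hApos, abs_two]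
        have : A * |y| ≤ A * (Real.pi / A) := by gcongr
        rw [mul_div_cancel₀ _ hApos.ne'] at this
        linarith
      have h1 := Real.mul_abs_le_abs_sin habs
      rw [abs_div, abs_mul, abs_of_pos hApos, abs_two] at h1
      have h2 : 2 / Real.pi * (A * (4 * Real.pi * x) / 2) < 2 / Real.pi * (A * |y| / 2) := by
        gcongr
      have h3 : 2 / Real.pi * (A * (4 * Real.pi * x) / 2) = 4 * A * x := by field_simp
      linarith
    have hsy : 1 / (A : ℝ) ≤ |Real.sin (y / 2)| := by
      have habs : |y / 2| ≤ Real.pi / 2 := by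
        rw [abs_div, abs_two]; linarith
      refine le_trans ?_ (Real.mul_abs_le_abs_sin habs)
      rw [abs_div, abs_two]
      have : 2 / Real.pi * (Real.pi / A / 2) ≤ 2 / Real.pi * (|y| / 2) := by gcongr
      refine le_trans (le_of_eq ?_) this
      field_simp
    have hf2 : (1 : ℝ) ≤ 1 / (8 * A ^ 2 * x) := by
      rw [le_div_iff₀ (by positivity)]
      linarith
    set K := ⌊1 / (8 * A ^ 2 * x)⌋₊ with hK
    have hKle : (K : ℝ) ≤ 1 / (8 * A ^ 2 * x) := Nat.floor_le (by positivity)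
    have hKge : 1 / (8 * A ^ 2 * x) / 2 ≤ (K : ℝ) := half_le_floor hf2
    have hK1 : A * K * x ≤ 1 := by
      rw [le_div_iff₀ (by positivity)] at hKle
      have : 0 ≤ (K : ℝ) * (A * x) := by positivity
      nlinarith
    have hsin : ∀ j < K, 1 / (2 * (A : ℝ)) ≤ |Real.sin ((A * j + 1) * y / 2)| := by
      intro j hj
      have hjK : (j : ℝ) ≤ K := by exact_mod_cast hj.le
      have h1 := abs_sin_le_abs_sin_add (j * (A * y / 2)) (y / 2)
      rw [show (j : ℝ) * (A * y / 2) + y / 2 = (A * j + 1) * y / 2 by ring] at h1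
      have h2 := abs_sin_nat_mul_le (A * y / 2) j
      have h3 : (j : ℝ) * |Real.sin (A * y / 2)| ≤ 1 / (8 * A ^ 2 * x) * (4 * A * x) := by
        gcongr
        · exact hjK.trans hKle
        · exact hs.le.trans hsA
      have h4 : 1 / (8 * A ^ 2 * x) * (4 * A * x) = 1 / (2 * (A : ℝ)) := by field_simp; norm_num
      have h5 : 1 / (A : ℝ) = 1 / (2 * A) + 1 / (2 * A) := by field_simp; norm_num
      linarith
    refine (norm_pleFun_le hA k hx K (fun j => (1 / (2 * (A : ℝ))) ^ 2) hK1
      (fun _ _ => by positivity) (fun _ _ => ?_) fun j hj => ?_).trans ?_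
    · have : 1 / (2 * (A : ℝ)) ≤ 1 := by
        rw [div_le_one (by positivity)]; linarith
      have : (1 / (2 * (A : ℝ))) ^ 2 ≤ 1 ^ 2 := by gcongr
      linarith
    · have h1 := hu hK1 hj
      rw [← sq_abs (Real.sin _)]
      calc _ ≤ (1 / (2 * (A : ℝ))) ^ 2 * 1 ^ 2 := by gcongr
        _ ≤ |Real.sin ((A * j + 1) * y / 2)| ^ 2 * 1 ^ 2 := by
          have := hsin j hj
          gcongr
        _ = _ := by ring
    · refine mul_le_mul_of_nonneg_left (Real.exp_le_exp.2 (neg_le_neg ?_)) (norm_nonneg _)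
      rw [sum_const, card_range, nsmul_eq_mul]
      have h1 : 1 / (8 * A ^ 2 * x) / 2 * (1 / (2 * (A : ℝ))) ^ 2 / 34 ≤
        K * (1 / (2 * (A : ℝ))) ^ 2 / 34 := by gcongr
      refine le_trans ?_ h1
      have e : 1 / (8 * A ^ 2 * x) / 2 * (1 / (2 * (A : ℝ))) ^ 2 / 34 =
        1 / (2176 * A ^ 4) / x := by field_simp; norm_num
      rw [e]
      gcongr
      norm_num

end MinorArcBound

section SaddlePoint

open Filter Topology

lemma tendsto_div_one_sub_exp_neg_pow {m : ℕ} (hm : m ≠ 0) :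
    Tendsto (fun z : ℂ => z * (1 - Complex.exp (-z) ^ m)⁻¹) (𝓝[≠] 0) (𝓝 (m : ℂ)⁻¹) := by
  have hd : HasDerivAt (fun z : ℂ => 1 - Complex.exp (-z) ^ m) (m : ℂ) 0 := by
    have h1 : HasDerivAt (fun z : ℂ => Complex.exp (-z)) (-1) 0 := by
      simpa using (hasDerivAt_neg (0 : ℂ)).cexp
    simpa using (h1.pow m).const_sub 1
  have := (hasDerivAt_iff_tendsto_slope.1 hd).inv₀ (by exact_mod_cast hm)
  refine this.congr fun z => ?_
  simp [slope_def_field, div_eq_mul_inv]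

/-- The tilt `1 + i√x t` of the rescaled contour. -/
noncomputable def tilt (t x : ℝ) : ℂ := 1 + (Real.sqrt x * t : ℝ) * Complex.I

lemma tendsto_tilt (t : ℝ) : Tendsto (tilt t) (𝓝[>] 0) (𝓝 1) := by
  have : Continuous (tilt t) := by
    unfold tilt
    fun_prop
  have h := this.tendsto 0
  simp only [tilt, Real.sqrt_zero, zero_mul, Complex.ofReal_zero, add_zero] at h
  exact h.mono_left nhdsWithin_le_nhds

lemma tilt_ne_zero (t x : ℝ) : tilt t x ≠ 0 := by
  intro h
  have := congrArg Complex.re h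
  simp [tilt] at this

lemma tendsto_mul_tilt (t : ℝ) :
    Tendsto (fun x : ℝ => (x : ℂ) * tilt t x) (𝓝[>] 0) (𝓝[≠] 0) := by
  refine tendsto_nhdsWithin_iff.2 ⟨?_, ?_⟩
  · have h1 : Tendsto (fun x : ℝ => (x : ℂ)) (𝓝[>] 0) (𝓝 0) :=
      (Complex.continuous_ofReal.tendsto' 0 0 (by simp)).mono_left nhdsWithin_le_nhds
    simpa using h1.mul (tendsto_tilt t)
  · filter_upwards [self_mem_nhdsWithin] with x hx
    exact mul_ne_zero (by exact_mod_cast (ne_of_gt hx)) (tilt_ne_zero t x)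

lemma tendsto_eulerProd_exp_neg_div (t : ℝ) {a : ℝ} (ha : 0 < a) :
    Tendsto (fun x : ℝ => eulerProd (Complex.exp (-((a : ℂ) / (x * tilt t x)))))
      (𝓝[>] 0) (𝓝 1) := by
  refine tendsto_eulerProd_zero.comp (Complex.tendsto_exp_comap_re_atBot.comp ?_)
  rw [tendsto_comap_iff]
  have h1 : Tendsto (fun x : ℝ => ((tilt t x)⁻¹).re) (𝓝[>] 0) (𝓝 1) := by
    have := (Complex.continuous_re.tendsto _).comp ((tendsto_tilt t).inv₀ one_ne_zero)
    rw [inv_one, Complex.one_re] at this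
    exact this
  have h2 : Tendsto (fun x : ℝ => a * x⁻¹) (𝓝[>] 0) atTop :=
    tendsto_inv_nhdsGT_zero.const_mul_atTop ha
  have h3 := tendsto_neg_atTop_atBot.comp (h2.atTop_mul_pos one_pos h1)
  refine h3.congr fun x => ?_
  simp only [Function.comp]
  have : -((a : ℂ) / (x * tilt t x)) = ((-(a * x⁻¹) : ℝ) : ℂ) * (tilt t x)⁻¹ := by
    push_cast
    rw [div_eq_mul_inv, mul_inv]
    ring
  rw [this, Complex.re_ofReal_mul]
  ring

/-- The exponential growth rate of `pleFun` at the origin. -/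
noncomputable def growthConst (A : ℕ) : ℝ := Real.pi ^ 2 / 6 * (1 - 1 / A)

lemma growthConst_pos {A : ℕ} (hA : 2 ≤ A) : 0 < growthConst A := by
  have hA2 : (2 : ℝ) ≤ A := by exact_mod_cast hA
  have : 1 / (A : ℝ) < 1 := by rw [div_lt_one] <;> linarith
  have h2 : 0 < 1 - 1 / (A : ℝ) := by linarith
  have := Real.pi_pos
  unfold growthConst
  positivity

lemma tendsto_pleFun_scaled {A : ℕ} (hA : 0 < A) (k : ℕ) (t : ℝ) :
    Tendsto (fun x : ℝ => pleFun A k (x + (x * Real.sqrt x * t : ℝ) * Complex.I) *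
      Complex.exp ((growthConst A / x ^ 2 * (x * Real.sqrt x * t) : ℝ) * Complex.I) *
      (x ^ k * Real.exp (-(growthConst A / x)) : ℝ)) (𝓝[>] 0)
      (𝓝 (((Real.sqrt A)⁻¹ * ((A : ℝ) ^ k * k.factorial)⁻¹ *
        Real.exp (-growthConst A * t ^ 2) : ℝ) : ℂ)) := by
  set C := growthConst A with hC
  have hA0 : (A : ℂ) ≠ 0 := by exact_mod_cast hA.ne'
  have hpi := Real.pi_pos
  have hAr : (0 : ℝ) < A := by exact_mod_cast hA
  have t1 : Tendsto (fun x : ℝ => Complex.exp ((A - 1) * ((x : ℂ) * tilt t x) / 24))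
      (𝓝[>] 0) (𝓝 1) := by
    have hc : Continuous fun z : ℂ => Complex.exp ((A - 1) * z / 24) := by fun_prop
    have := (hc.tendsto' 0 1 (by simp)).comp ((tendsto_mul_tilt t).mono_right nhdsWithin_le_nhds)
    exact this
  have t2 : Tendsto (fun x : ℝ => Complex.exp (-(C * t ^ 2) / tilt t x)) (𝓝[>] 0)
      (𝓝 (Complex.exp (-(C * t ^ 2)))) := by
    have := (Complex.continuous_exp.tendsto _).comp
      ((tendsto_const_nhds (x := -((C : ℂ) * t ^ 2))).div (tendsto_tilt t) one_ne_zero)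
    rw [div_one] at this
    exact this
  have t3 : Tendsto (fun x : ℝ =>
      eulerProd (Complex.exp (-(((4 * Real.pi ^ 2 / A : ℝ) : ℂ) / (x * tilt t x)))) /
      eulerProd (Complex.exp (-(((4 * Real.pi ^ 2 : ℝ) : ℂ) / (x * tilt t x)))))
      (𝓝[>] 0) (𝓝 1) := by
    have := (tendsto_eulerProd_exp_neg_div t (a := 4 * Real.pi ^ 2 / A) (by positivity)).div
      (tendsto_eulerProd_exp_neg_div t (a := 4 * Real.pi ^ 2) (by positivity)) one_ne_zero
    rw [div_one] at this
    exact this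
  have t4 : Tendsto (fun x : ℝ => ∏ j ∈ range k, (((x : ℂ) * tilt t x) *
      (1 - Complex.exp (-((x : ℂ) * tilt t x)) ^ (A * (j + 1)))⁻¹ * (tilt t x)⁻¹))
      (𝓝[>] 0) (𝓝 (∏ j ∈ range k, ((A * (j + 1) : ℕ) : ℂ)⁻¹)) := by
    refine tendsto_finsetProd _ fun j _ => ?_
    have h1 := (tendsto_div_one_sub_exp_neg_pow (m := A * (j + 1)) (by positivity)).comp
      (tendsto_mul_tilt t)
    have := h1.mul ((tendsto_tilt t).inv₀ one_ne_zero)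
    simpa using this
  have tt := (((t1.const_mul ((Real.sqrt A : ℂ)⁻¹)).mul t2).mul t3).mul t4
  have hprod : (∏ j ∈ range k, ((A * (j + 1) : ℕ) : ℂ)⁻¹) = ((A : ℂ) ^ k * k.factorial)⁻¹ := by
    rw [prod_inv_distrib]
    push_cast
    rw [prod_mul_distrib, prod_const, card_range, ← prod_range_add_one_eq_factorial]
    push_cast
    rfl
  have hval : (((Real.sqrt A)⁻¹ * ((A : ℝ) ^ k * k.factorial)⁻¹ *
        Real.exp (-C * t ^ 2) : ℝ) : ℂ) =
      (Real.sqrt A : ℂ)⁻¹ * 1 * Complex.exp (-(C * t ^ 2)) * 1 *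
        ∏ j ∈ range k, ((A * (j + 1) : ℕ) : ℂ)⁻¹ := by
    rw [hprod]
    push_cast
    rw [neg_mul]
    ring
  rw [hval]
  refine tt.congr' ?_
  filter_upwards [self_mem_nhdsWithin] with x hx
  have hx' : (0 : ℝ) < x := hx
  have hx0 : (x : ℂ) ≠ 0 := by exact_mod_cast hx'.ne'
  have hw := tilt_ne_zero t x
  have hz : (x : ℂ) + (x * Real.sqrt x * t : ℝ) * Complex.I = x * tilt t x := by
    rw [tilt]
    push_cast
    ring
  have hre : 0 < ((x : ℂ) * tilt t x).re := by
    rw [← hz]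
    simpa using hx'
  rw [hz, pleFun, eulerProd_div_eq hA hre]
  have hexp : Complex.exp (Real.pi ^ 2 / 6 * (1 - 1 / A) / (x * tilt t x)) *
      Complex.exp ((C / x ^ 2 * (x * Real.sqrt x * t) : ℝ) * Complex.I) *
      Complex.exp (-(C / x)) = Complex.exp (-(C * t ^ 2) / tilt t x) := by
    rw [← Complex.exp_add, ← Complex.exp_add]
    congr 1
    have hC' : (Real.pi : ℂ) ^ 2 / 6 * (1 - 1 / A) = C := by
      rw [hC, growthConst]
      push_cast
      ring
    rw [hC']
    have hs : ((Real.sqrt x : ℝ) : ℂ) ^ 2 = x := by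
      rw [← Complex.ofReal_pow, Real.sq_sqrt hx'.le]
    have htl : tilt t x = 1 + Real.sqrt x * t * Complex.I := by
      rw [tilt]
      push_cast
      ring
    push_cast
    field_simp
    rw [htl]
    linear_combination (C * t ^ 2 : ℂ) * (Real.sqrt x : ℂ) ^ 2 * Complex.I_sq - C * t ^ 2 * hs
  rw [← hexp]
  have e1 : ((4 * Real.pi ^ 2 / A : ℝ) : ℂ) / (x * tilt t x) =
      4 * Real.pi ^ 2 / (A * (x * tilt t x)) := by
    push_cast
    rw [div_div]
  rw [e1]
  have e2 : ∏ j ∈ range k, (((x : ℂ) * tilt t x) *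
      (1 - Complex.exp (-((x : ℂ) * tilt t x)) ^ (A * (j + 1)))⁻¹ * (tilt t x)⁻¹) =
      (x : ℂ) ^ k * ∏ j ∈ range k,
        (1 - Complex.exp (-((x : ℂ) * tilt t x)) ^ (A * (j + 1)))⁻¹ := by
    rw [← card_range k, ← prod_const, card_range, ← prod_mul_distrib]
    refine prod_congr rfl fun j _ => ?_
    field_simp
  rw [e2]
  push_cast
  ring

end SaddlePoint

section Asymptotics

open Filter Topology MeasureTheory

lemma continuous_pleFun_vertical {A : ℕ} (hA : 0 < A) (k : ℕ) {x : ℝ} (hx : 0 < x) :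
    Continuous fun y : ℝ => pleFun A k (x + y * Complex.I) := by
  have hre : ∀ y : ℝ, 0 < ((x : ℂ) + y * Complex.I).re := by intro y; simpa using hx
  have hon : ContinuousOn eulerProd (Metric.ball 0 1) :=
    ModularForm.differentiableOn_tprod_one_sub_pow.continuousOn
  have hE : Continuous fun y : ℝ => Complex.exp (-((x : ℂ) + y * Complex.I)) := by fun_prop
  have h1 : Continuous fun y : ℝ => eulerProd (Complex.exp (-((x : ℂ) + y * Complex.I))) :=
    hon.comp_continuous hE fun y => by simpa using norm_exp_neg_lt_one (hre y)
  have h2 : Continuous fun y : ℝ => eulerProd (Complex.exp (-((x : ℂ) + y * Complex.I)) ^ A) :=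
    hon.comp_continuous (hE.pow A) fun y => by
      simpa using norm_pow_lt_one (norm_exp_neg_lt_one (hre y)) hA
  refine (h2.div h1 fun y => eulerProd_ne_zero (norm_exp_neg_lt_one (hre y))).mul ?_
  refine continuous_finsetProd _ fun j _ => Continuous.inv₀ (by fun_prop) fun y => ?_
  exact one_sub_pow_ne_zero (norm_exp_neg_lt_one (hre y)) (by positivity)

lemma exp_add_exp_le {c x t : ℝ} (hc : 0 < c) (hx : 0 < x) (hx1 : x ≤ 1)
    (ht : |x * Real.sqrt x * t| ≤ Real.pi) :
    Real.exp (-(c * t ^ 2)) + Real.exp (-(c / x)) ≤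
      ((1 + 1 / c) + (1 + Real.pi ^ 2) * 6 / c ^ 3) * (1 + t ^ 2)⁻¹ := by
  have h1t : 0 < 1 + t ^ 2 := by positivity
  rw [add_mul]
  refine add_le_add ?_ ?_
  · rw [Real.exp_neg, ← div_eq_mul_inv, inv_eq_one_div, div_le_div_iff₀ (Real.exp_pos _) h1t,
      one_mul]
    have h := Real.add_one_le_exp (c * t ^ 2)
    calc 1 + t ^ 2 ≤ (1 + 1 / c) * (c * t ^ 2 + 1) := by
          have : (1 + 1 / c) * (c * t ^ 2 + 1) = c * t ^ 2 + 1 + t ^ 2 + 1 / c := by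
            field_simp; ring
          rw [this]
          have : 0 ≤ c * t ^ 2 + 1 / c := by positivity
          linarith
      _ ≤ _ := by gcongr
  · rw [Real.exp_neg, ← div_eq_mul_inv, inv_eq_one_div, div_le_div_iff₀ (Real.exp_pos _) h1t,
      one_mul]
    have h := Real.pow_div_factorial_le_exp (c / x) (by positivity) 3
    have hx3 : x ^ 3 ≤ 1 := pow_le_one₀ hx.le hx1
    have hsq : x ^ 3 * t ^ 2 ≤ Real.pi ^ 2 := by
      have : (x * Real.sqrt x * t) ^ 2 ≤ Real.pi ^ 2 := by
        rw [← sq_abs]; gcongr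
      rw [mul_pow, mul_pow, Real.sq_sqrt hx.le] at this
      linarith
    calc 1 + t ^ 2 = (x ^ 3 + x ^ 3 * t ^ 2) / x ^ 3 := by field_simp
      _ ≤ (1 + Real.pi ^ 2) / x ^ 3 := by gcongr
      _ = (1 + Real.pi ^ 2) * 6 / c ^ 3 * ((c / x) ^ 3 / (Nat.factorial 3 : ℕ)) := by
          simp only [Nat.factorial]
          push_cast
          field_simp
      _ ≤ _ := by gcongr

lemma norm_pleFun_le_scaled {A : ℕ} (hA : 2 ≤ A) (k : ℕ) {x t : ℝ} (hx : 0 < x)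
    (hx1 : 8 * A ^ 2 * x ≤ 1) (ht : |x * Real.sqrt x * t| ≤ Real.pi) :
    ‖pleFun A k (x + (x * Real.sqrt x * t : ℝ) * Complex.I)‖ ≤
      ‖pleFun A k x‖ * (Real.exp (-(1 / (10000 * A ^ 4) * t ^ 2)) +
        Real.exp (-(1 / (10000 * A ^ 4) / x))) := by
  rcases le_or_gt |x * Real.sqrt x * t| (4 * Real.pi * x) with h | h
  · refine (norm_pleFun_le_near hA k hx hx1 h).trans ?_
    have : (x * Real.sqrt x * t) ^ 2 / x ^ 3 = t ^ 2 := by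
      rw [mul_pow, mul_pow, Real.sq_sqrt hx.le]
      field_simp
    rw [this]
    gcongr
    exact le_add_of_nonneg_right (Real.exp_pos _).le
  · refine (norm_pleFun_le_far hA k hx hx1 h ht).trans ?_
    gcongr
    exact le_add_of_nonneg_left (Real.exp_pos _).le

/-- The Cauchy integrand after rescaling the contour, cut off to one period. -/
noncomputable def scaledIntegrand (A k : ℕ) (x : ℝ) : ℝ → ℂ :=
  Set.indicator (Set.Ioc (-(Real.pi / (x * Real.sqrt x))) (Real.pi / (x * Real.sqrt x)))
    fun t => pleFun A k (x + (x * Real.sqrt x * t : ℝ) * Complex.I) *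
      Complex.exp ((growthConst A / x ^ 2 * (x * Real.sqrt x * t) : ℝ) * Complex.I) *
      (x ^ k * Real.exp (-(growthConst A / x)) : ℝ)

lemma abs_le_pi_of_mem {x t : ℝ} (hx : 0 < x)
    (ht : t ∈ Set.Ioc (-(Real.pi / (x * Real.sqrt x))) (Real.pi / (x * Real.sqrt x))) :
    |x * Real.sqrt x * t| ≤ Real.pi := by
  have h0 : 0 < x * Real.sqrt x := mul_pos hx (Real.sqrt_pos.2 hx)
  have h1 : |t| ≤ Real.pi / (x * Real.sqrt x) := abs_le.2 ⟨ht.1.le, ht.2⟩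
  rw [le_div_iff₀ h0] at h1
  rw [abs_mul, abs_of_pos h0]
  linarith

lemma tendsto_integral_scaledIntegrand {A : ℕ} (hA : 2 ≤ A) (k : ℕ) :
    Tendsto (fun x : ℝ => ∫ t, scaledIntegrand A k x t) (𝓝[>] 0)
      (𝓝 (((Real.sqrt A)⁻¹ * ((A : ℝ) ^ k * k.factorial)⁻¹ *
        Real.sqrt (Real.pi / growthConst A) : ℝ) : ℂ)) := by
  have hA0 : 0 < A := by omega
  have hAr : (0 : ℝ) < A := by exact_mod_cast hA0
  set L := (Real.sqrt A)⁻¹ * ((A : ℝ) ^ k * k.factorial)⁻¹ with hL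
  set C := growthConst A with hC
  have hlim : (∫ t : ℝ, ((L * Real.exp (-C * t ^ 2) : ℝ) : ℂ)) =
      ((L * Real.sqrt (Real.pi / C) : ℝ) : ℂ) := by
    rw [integral_complex_ofReal, integral_const_mul, integral_gaussian]
  rw [← hlim]
  have h0 := tendsto_pleFun_scaled hA0 k 0
  have hbdd := h0.norm.eventually_le_const (lt_add_one _)
  set M := ‖(((Real.sqrt A)⁻¹ * ((A : ℝ) ^ k * k.factorial)⁻¹ *
        Real.exp (-growthConst A * 0 ^ 2) : ℝ) : ℂ)‖ + 1 with hM
  set c : ℝ := 1 / (10000 * A ^ 4) with hc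
  have hcpos : 0 < c := by positivity
  set K := (1 + 1 / c) + (1 + Real.pi ^ 2) * 6 / c ^ 3 with hK
  have hKpos : 0 < K := by positivity
  have hMpos : 0 < M := by positivity
  have hsmall : ∀ᶠ x : ℝ in 𝓝[>] 0, x ≤ 1 / (8 * A ^ 2) :=
    (eventually_le_nhds (by positivity)).filter_mono nhdsWithin_le_nhds
  refine tendsto_integral_filter_of_dominated_convergence (fun t => M * (K * (1 + t ^ 2)⁻¹))
    ?_ ?_ ?_ ?_
  · filter_upwards [self_mem_nhdsWithin] with x hx
    refine Continuous.aestronglyMeasurable ?_ |>.indicator measurableSet_Ioc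
    have := (continuous_pleFun_vertical hA0 k hx).comp
      (by fun_prop : Continuous fun t : ℝ => x * Real.sqrt x * t)
    refine (Continuous.mul this ?_).mul continuous_const
    fun_prop
  · filter_upwards [self_mem_nhdsWithin, hsmall, hbdd] with x hx hxs hb
    have hx' : (0 : ℝ) < x := hx
    refine Eventually.of_forall fun t => ?_
    rw [scaledIntegrand, Set.indicator_apply]
    split_ifs with ht
    · have hpi := abs_le_pi_of_mem hx' ht
      have hx8 : 8 * A ^ 2 * x ≤ 1 := by
        rw [le_div_iff₀ (by positivity)] at hxs
        linarith
      have hx1 : x ≤ 1 := hxs.trans (by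
        rw [div_le_one (by positivity)]
        have : (1 : ℝ) ≤ A := by exact_mod_cast hA0
        nlinarith)
      have h1 := norm_pleFun_le_scaled hA k hx' hx8 hpi
      have h2 := exp_add_exp_le hcpos hx' hx1 hpi
      have h3 : ‖pleFun A k x‖ * ‖((x ^ k * Real.exp (-(C / x)) : ℝ) : ℂ)‖ ≤ M := by
        refine le_trans (le_of_eq ?_) hb
        rw [norm_mul, norm_mul]
        simp [hC]
      rw [norm_mul, norm_mul, Complex.norm_exp_ofReal_mul_I, mul_one]
      calc _ ≤ (‖pleFun A k x‖ * (K * (1 + t ^ 2)⁻¹)) *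
            ‖((x ^ k * Real.exp (-(C / x)) : ℝ) : ℂ)‖ := by
              gcongr
              refine h1.trans ?_
              gcongr
        _ = (‖pleFun A k x‖ * ‖((x ^ k * Real.exp (-(C / x)) : ℝ) : ℂ)‖) *
            (K * (1 + t ^ 2)⁻¹) := by ring
        _ ≤ _ := by gcongr
    · rw [norm_zero]
      positivity
  · exact (integrable_inv_one_add_sq.const_mul K).const_mul M
  · refine Eventually.of_forall fun t => ?_
    refine (tendsto_pleFun_scaled hA0 k t).congr' ?_
    have hR : Tendsto (fun x : ℝ => x * Real.sqrt x * |t|) (𝓝[>] 0) (𝓝 0) := by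
      have hcont : Continuous fun x : ℝ => x * Real.sqrt x * |t| := by fun_prop
      exact (hcont.tendsto' 0 0 (by simp)).mono_left nhdsWithin_le_nhds
    filter_upwards [self_mem_nhdsWithin, hR.eventually_lt_const Real.pi_pos] with x hx hxt
    have hx' : (0 : ℝ) < x := hx
    have hs : 0 < x * Real.sqrt x := mul_pos hx' (Real.sqrt_pos.2 hx')
    have habs : |t| < Real.pi / (x * Real.sqrt x) := by
      rw [lt_div_iff₀ hs]
      linarith
    rw [scaledIntegrand, Set.indicator_of_mem]
    exact ⟨(abs_lt.1 habs).1, (abs_lt.1 habs).2.le⟩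

lemma integral_scaledIntegrand {A : ℕ} (hA : 0 < A) (k n : ℕ) {x : ℝ} (hx : 0 < x)
    (hn : growthConst A / x ^ 2 = n) :
    ∫ t, scaledIntegrand A k x t =
      (((x * Real.sqrt x)⁻¹ * (2 * Real.pi * (pleA A k n * Real.exp (-(n * x)))) *
        (x ^ k * Real.exp (-(growthConst A / x))) : ℝ) : ℂ) := by
  have hs : 0 < x * Real.sqrt x := mul_pos hx (Real.sqrt_pos.2 hx)
  have hpi := Real.pi_pos
  have hR : 0 < Real.pi / (x * Real.sqrt x) := by positivity
  unfold scaledIntegrand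
  rw [integral_indicator measurableSet_Ioc, ← intervalIntegral.integral_of_le (by linarith),
    intervalIntegral.integral_mul_const, hn]
  have hsub := intervalIntegral.integral_comp_mul_left
    (fun y : ℝ => pleFun A k (x + y * Complex.I) * Complex.exp (n * y * Complex.I)) hs.ne'
    (a := -(Real.pi / (x * Real.sqrt x))) (b := Real.pi / (x * Real.sqrt x))
  rw [mul_neg, mul_div_cancel₀ _ hs.ne', pleA_eq_integral hA k n hx] at hsub
  have e : ∀ t : ℝ, (((n : ℝ) * (x * Real.sqrt x * t) : ℝ) : ℂ) =
      (n : ℂ) * ((x * Real.sqrt x * t : ℝ) : ℂ) := by intro t; push_cast; ring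
  simp only [e]
  rw [hsub, Complex.real_smul]
  push_cast
  ring

end Asymptotics

section MainTheorem

open Filter Topology

/-- Closed form of the constant obtained from the saddle-point method. -/
lemma saddle_const_eq {A : ℕ} (hA : 2 ≤ A) (k : ℕ) {n : ℝ} (hn : 0 < n) :
    (24 : ℝ) ^ ((k : ℝ) / 2 - 1 / 4) * n ^ ((k : ℝ) / 2 - 3 / 4) /
        (Real.sqrt 2 * (1 - 1 / (A : ℝ)) ^ ((k : ℝ) / 2 - 1 / 4) *
          (Nat.factorial k : ℝ) * (A : ℝ) ^ ((k : ℝ) + 1 / 2) * (2 * Real.pi) ^ k) =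
      (Real.sqrt A)⁻¹ * ((A : ℝ) ^ k * k.factorial)⁻¹ * Real.sqrt (Real.pi / growthConst A) *
        (Real.sqrt (growthConst A / n) * Real.sqrt (Real.sqrt (growthConst A / n)) /
          Real.sqrt (growthConst A / n) ^ k / (2 * Real.pi)) := by
  have hA2 : (2 : ℝ) ≤ A := by exact_mod_cast hA
  have hApos : (0 : ℝ) < A := by linarith
  have hB : 0 < 1 - 1 / (A : ℝ) := by
    have : 1 / (A : ℝ) < 1 := by rw [div_lt_one] <;> linarith
    linarith
  have hpi := Real.pi_pos
  have hC := growthConst_pos hA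
  have hfac : (0 : ℝ) < k.factorial := by exact_mod_cast k.factorial_pos
  have hlogC : Real.log (growthConst A) =
      2 * Real.log Real.pi - Real.log 6 + Real.log (1 - 1 / (A : ℝ)) := by
    rw [growthConst, Real.log_mul (by positivity) hB.ne', Real.log_div (by positivity) (by norm_num),
      Real.log_pow]
    norm_num
  have h24 : Real.log 24 = 2 * Real.log 2 + Real.log 6 := by
    rw [show (24 : ℝ) = 2 ^ 2 * 6 by norm_num, Real.log_mul (by norm_num) (by norm_num),
      Real.log_pow]
    norm_num
  set B := 1 - 1 / (A : ℝ) with hBdef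
  set C := growthConst A with hCdef
  refine Real.log_injOn_pos (Set.mem_Ioi.2 (by positivity)) (Set.mem_Ioi.2 (by positivity)) ?_
  rw [Real.log_div (by positivity) (by positivity), Real.log_mul (by positivity) (by positivity),
    Real.log_mul (by positivity) (by positivity), Real.log_mul (by positivity) (by positivity),
    Real.log_mul (by positivity) (by positivity), Real.log_mul (by positivity) (by positivity),
    Real.log_mul (by positivity) (by positivity), Real.log_mul (by positivity) (by positivity),
    Real.log_mul (by positivity) (by positivity), Real.log_inv, Real.log_inv,
    Real.log_mul (by positivity) (by positivity),
    Real.log_div (by positivity) (by positivity), Real.log_div (by positivity) (by positivity),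
    Real.log_mul (by positivity) (by positivity), Real.log_mul (by positivity) (by positivity),
    Real.log_pow, Real.log_pow, Real.log_pow, Real.log_mul (by positivity) (by positivity),
    Real.log_rpow (by positivity), Real.log_rpow (by positivity), Real.log_rpow (by positivity),
    Real.log_rpow (by positivity), Real.log_sqrt (by positivity), Real.log_sqrt (by positivity),
    Real.log_sqrt (by positivity), Real.log_sqrt (by positivity), Real.log_sqrt (by positivity),
    Real.log_sqrt (by positivity),
    Real.log_div (by positivity) (by positivity), Real.log_div (by positivity) (by positivity),
    hlogC, h24]
  ring

end MainTheorem

theorem stmt12 (A k : ℕ) (hA : 2 ≤ A) :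
    Filter.Tendsto
      (fun n : ℕ => (pleA A k n : ℝ) /
        ((24 : ℝ) ^ ((k : ℝ) / 2 - 1 / 4) * (n : ℝ) ^ ((k : ℝ) / 2 - 3 / 4) /
          (Real.sqrt 2 * (1 - 1 / (A : ℝ)) ^ ((k : ℝ) / 2 - 1 / 4) *
            (Nat.factorial k : ℝ) * (A : ℝ) ^ ((k : ℝ) + 1 / 2) * (2 * Real.pi) ^ k) *
          Real.exp (2 * Real.pi * Real.sqrt (1 / 6 * (1 - 1 / (A : ℝ)) * (n : ℝ)))))
      Filter.atTop (nhds 1) := by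
  have hA0 : 0 < A := by omega
  have hAr : (0 : ℝ) < A := by exact_mod_cast hA0
  have hC := growthConst_pos hA
  have hpi := Real.pi_pos
  have hx : Filter.Tendsto (fun n : ℕ => Real.sqrt (growthConst A / n)) Filter.atTop
      (nhdsWithin 0 (Set.Ioi 0)) := by
    refine tendsto_nhdsWithin_iff.2 ⟨?_, ?_⟩
    · have := (tendsto_const_div_atTop_nhds_zero_nat (growthConst A)).sqrt
      rwa [Real.sqrt_zero] at this
    · filter_upwards [Filter.eventually_gt_atTop 0] with n hn
      have : (0 : ℝ) < n := by exact_mod_cast hn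
      exact Set.mem_Ioi.2 (by positivity)
  have hlim := (tendsto_integral_scaledIntegrand hA k).comp hx
  set L := (Real.sqrt A)⁻¹ * ((A : ℝ) ^ k * k.factorial)⁻¹ *
    Real.sqrt (Real.pi / growthConst A) with hL
  have hLpos : 0 < L := by positivity
  have hre := ((Complex.continuous_re.tendsto _).comp hlim).div_const L
  rw [Complex.ofReal_re, div_self hLpos.ne'] at hre
  refine hre.congr' ?_
  filter_upwards [Filter.eventually_gt_atTop 0] with n hn
  have hn0 : (0 : ℝ) < n := by exact_mod_cast hn
  rw [saddle_const_eq hA k hn0, ← hL]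
  simp only [Function.comp]
  set x := Real.sqrt (growthConst A / n) with hxdef
  have hxpos : 0 < x := by positivity
  have hx2 : x ^ 2 = growthConst A / n := Real.sq_sqrt (by positivity)
  have hnx : growthConst A / x ^ 2 = n := by
    rw [hx2]
    field_simp
  have hCx : growthConst A / x = n * x := by
    rw [← hnx]
    field_simp
  rw [integral_scaledIntegrand hA0 k n hxpos hnx, Complex.ofReal_re, hCx]
  have hexp : 2 * Real.pi * Real.sqrt (1 / 6 * (1 - 1 / (A : ℝ)) * n) = n * x + n * x := by
    have h1 : growthConst A * n = (n * x) ^ 2 := by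
      rw [mul_pow, hx2]
      field_simp
    have h2 : Real.pi * Real.sqrt (1 / 6 * (1 - 1 / (A : ℝ)) * n) =
        Real.sqrt (growthConst A * n) := by
      rw [← Real.sqrt_sq hpi.le, ← Real.sqrt_mul (by positivity), growthConst]
      congr 1
      ring
    rw [mul_assoc, h2, h1, Real.sqrt_sq (by positivity)]
    ring
  rw [hexp, Real.exp_add, Real.exp_neg]
  have hsx : 0 < Real.sqrt x := Real.sqrt_pos.2 hxpos
  have hE := Real.exp_pos (n * x)
  field_simp
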